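/- arXiv:2605.08865 — 2 statements merged into one kernel-verified Lean document; each statement's English description precedes it below -/
import Mathlib

section
/- Let σ ∈ (1/2, 1) be fixed and let θ ∈ [0, π/2) ∪ (3π/2, 2π] (so that cos θ > 0). There exists a constant C > 0 depending only on σ and θ such that for all sufficiently large prime numbers q there is a non-principal Dirichlet character χ modulo q with Re( e^{−iθ} · ∑_{p ≤ Y, p prime} χ(p) p^{−σ} ) ≥ C · (log q)^{1−σ} / (log log q)^{σ}, where Y = (log q)^{100/(σ − 1/2)}. -/
/-- The squared absolute value of the resonator `∏ p ∈ S, (1 + χ p)`. -/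
noncomputable def resonatorWeight {n : ℕ} (S : Finset ℕ) (χ : DirichletCharacter ℂ n) : ℝ :=
  ∏ p ∈ S, Complex.normSq (1 + χ (p : ZMod n))

lemma resonatorWeight_nonneg {n : ℕ} (S : Finset ℕ) (χ : DirichletCharacter ℂ n) :
    0 ≤ resonatorWeight S χ :=
  Finset.prod_nonneg fun _ _ => Complex.normSq_nonneg _

lemma resonatorWeight_one {n : ℕ} {S : Finset ℕ} (hS : ∀ p ∈ S, IsUnit (p : ZMod n)) :
    resonatorWeight S (1 : DirichletCharacter ℂ n) = 4 ^ S.card := by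
  unfold resonatorWeight
  rw [Finset.prod_congr rfl (g := fun _ => (4 : ℝ)), Finset.prod_const]
  intro p hp
  rw [MulChar.one_apply (hS p hp)]
  norm_num [Complex.normSq_apply]

lemma DirichletCharacter.norm_apply_of_isUnit {n : ℕ} (χ : DirichletCharacter ℂ n) {a : ZMod n}
    (ha : IsUnit a) : ‖χ a‖ = 1 := by
  obtain ⟨u, rfl⟩ := ha
  exact χ.unit_norm_eq_one u

lemma DirichletCharacter.normSq_one_add_apply {n : ℕ} (χ : DirichletCharacter ℂ n) {a : ZMod n}
    (ha : IsUnit a) : (Complex.normSq (1 + χ a) : ℂ) = 2 + χ a + χ a⁻¹ := by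
  have h1 : χ a * χ a⁻¹ = 1 := by
    rw [← map_mul, ZMod.mul_inv_of_unit _ ha, map_one]
  have h2 : (starRingEnd ℂ) (χ a) = χ a⁻¹ := by
    rw [eq_inv_of_mul_eq_one_right h1, Complex.inv_def, Complex.normSq_eq_norm_sq,
      χ.norm_apply_of_isUnit ha]
    simp
  rw [← Complex.mul_conj, map_add, map_one, h2]
  linear_combination h1

lemma two_mul_re_sub_one_mul_normSq {z : ℂ} (hz : ‖z‖ = 1) :
    (2 * z.re - 1) * Complex.normSq (1 + z) = 2 * z.re + 2 * (z * z).re := by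
  have h : z.re * z.re + z.im * z.im = 1 := by
    rw [← Complex.normSq_apply, Complex.normSq_eq_norm_sq, hz, one_pow]
  simp only [Complex.normSq_apply, Complex.add_re, Complex.add_im, Complex.one_re,
    Complex.one_im, Complex.mul_re]
  linear_combination (2 * z.re + 1) * h

lemma re_exp_mul_sum {n : ℕ} {T : Finset ℕ} (w : ℕ → ℝ) (θ : ℝ) (χ : DirichletCharacter ℂ n) :
    (Complex.exp (-(θ : ℂ) * Complex.I) * ∑ p ∈ T, χ (p : ZMod n) * (w p : ℂ)).re =
      ∑ p ∈ T, w p * (Real.cos θ * (χ (p : ZMod n)).re + Real.sin θ * (χ (p : ZMod n)).im) := by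
  rw [Finset.mul_sum, Complex.re_sum]
  refine Finset.sum_congr rfl fun p _ => ?_
  rw [← Complex.ofReal_neg, Complex.mul_re, Complex.exp_ofReal_mul_I_re,
    Complex.exp_ofReal_mul_I_im, Complex.re_mul_ofReal, Complex.im_mul_ofReal,
    Real.cos_neg, Real.sin_neg]
  ring

lemma sum_resonatorWeight_insert_mul {n : ℕ} {S : Finset ℕ} {p : ℕ} (hp : p ∉ S)
    (hu : IsUnit (p : ZMod n)) (a : ZMod n) :
    ∑ χ : DirichletCharacter ℂ n, (resonatorWeight (insert p S) χ : ℂ) * χ a =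
      2 * ∑ χ : DirichletCharacter ℂ n, (resonatorWeight S χ : ℂ) * χ a +
      ∑ χ : DirichletCharacter ℂ n, (resonatorWeight S χ : ℂ) * χ (p * a) +
      ∑ χ : DirichletCharacter ℂ n, (resonatorWeight S χ : ℂ) * χ ((p : ZMod n)⁻¹ * a) := by
  rw [Finset.mul_sum, ← Finset.sum_add_distrib, ← Finset.sum_add_distrib]
  refine Finset.sum_congr rfl fun χ _ => ?_
  rw [resonatorWeight, Finset.prod_insert hp, Complex.ofReal_mul,
    χ.normSq_one_add_apply hu, map_mul, map_mul, resonatorWeight]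
  ring

section

open scoped ComplexOrder

variable {n : ℕ} [NeZero n]

lemma sum_resonatorWeight_mul_nonneg {S : Finset ℕ} (hS : ∀ p ∈ S, IsUnit (p : ZMod n))
    (a : ZMod n) :
    0 ≤ ∑ χ : DirichletCharacter ℂ n, (resonatorWeight S χ : ℂ) * χ a := by
  induction S using Finset.induction_on generalizing a with
  | empty =>
    simp only [resonatorWeight, Finset.prod_empty, Complex.ofReal_one, one_mul,
      DirichletCharacter.sum_characters_eq]
    split_ifs
    · exact Nat.cast_nonneg _
    · exact le_rfl
  | insert p S hp ih =>
    have ih := ih fun r hr => hS r (Finset.mem_insert_of_mem hr)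
    rw [sum_resonatorWeight_insert_mul hp (hS p (Finset.mem_insert_self p S))]
    exact add_nonneg (add_nonneg (mul_nonneg zero_le_two (ih _)) (ih _)) (ih _)

lemma sum_resonatorWeight_mul_re_nonneg {S : Finset ℕ} (hS : ∀ p ∈ S, IsUnit (p : ZMod n))
    (a : ZMod n) :
    0 ≤ ∑ χ : DirichletCharacter ℂ n, resonatorWeight S χ * (χ a).re := by
  simpa using (Complex.nonneg_iff.1 (sum_resonatorWeight_mul_nonneg hS a)).1

lemma sum_resonatorWeight_mul_im {S : Finset ℕ} (hS : ∀ p ∈ S, IsUnit (p : ZMod n))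
    (a : ZMod n) :
    ∑ χ : DirichletCharacter ℂ n, resonatorWeight S χ * (χ a).im = 0 := by
  simpa using (Complex.nonneg_iff.1 (sum_resonatorWeight_mul_nonneg hS a)).2.symm

lemma two_pow_mul_totient_le_sum_resonatorWeight {S : Finset ℕ}
    (hS : ∀ p ∈ S, IsUnit (p : ZMod n)) :
    2 ^ S.card * (n.totient : ℝ) ≤ ∑ χ : DirichletCharacter ℂ n, resonatorWeight S χ := by
  have key : 2 ^ S.card * (n.totient : ℂ) ≤
      ∑ χ : DirichletCharacter ℂ n, (resonatorWeight S χ : ℂ) * χ 1 := by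
    induction S using Finset.induction_on with
    | empty =>
      simp [resonatorWeight, ← Nat.card_eq_fintype_card,
        DirichletCharacter.card_eq_totient_of_hasEnoughRootsOfUnity]
    | insert p S hp ih =>
      have hS' : ∀ r ∈ S, IsUnit (r : ZMod n) := fun r hr => hS r (Finset.mem_insert_of_mem hr)
      rw [sum_resonatorWeight_insert_mul hp (hS p (Finset.mem_insert_self p S)),
        Finset.card_insert_of_notMem hp, pow_succ', mul_assoc, add_assoc]
      exact le_add_of_le_of_nonneg (mul_le_mul_of_nonneg_left (ih hS') zero_le_two)
        (add_nonneg (sum_resonatorWeight_mul_nonneg hS' _)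
          (sum_resonatorWeight_mul_nonneg hS' _))
  simp only [map_one, mul_one] at key
  exact_mod_cast key

lemma sum_resonatorWeight_le_two_mul {S : Finset ℕ} (hS : ∀ p ∈ S, IsUnit (p : ZMod n))
    {p : ℕ} (hp : p ∈ S) :
    ∑ χ : DirichletCharacter ℂ n, resonatorWeight S χ ≤
      2 * ∑ χ : DirichletCharacter ℂ n, resonatorWeight S χ * (χ (p : ZMod n)).re := by
  have hS' : ∀ r ∈ S.erase p, IsUnit (r : ZMod n) := fun r hr => hS r (Finset.mem_of_mem_erase hr)
  have h : ∀ χ : DirichletCharacter ℂ n,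
      2 * (resonatorWeight S χ * (χ (p : ZMod n)).re) - resonatorWeight S χ =
      2 * (resonatorWeight (S.erase p) χ * (χ (p : ZMod n)).re) +
      2 * (resonatorWeight (S.erase p) χ * (χ ((p : ZMod n) * p)).re) := fun χ => by
    have hW : resonatorWeight S χ =
        Complex.normSq (1 + χ (p : ZMod n)) * resonatorWeight (S.erase p) χ :=
      (Finset.mul_prod_erase S _ hp).symm
    rw [hW, map_mul]
    linear_combination resonatorWeight (S.erase p) χ *
      two_mul_re_sub_one_mul_normSq (χ.norm_apply_of_isUnit (hS p hp))
  rw [← sub_nonneg, Finset.mul_sum, ← Finset.sum_sub_distrib, Finset.sum_congr rfl fun χ _ => h χ,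
    Finset.sum_add_distrib, ← Finset.mul_sum, ← Finset.mul_sum]
  have h1 := sum_resonatorWeight_mul_re_nonneg hS' (p : ZMod n)
  have h2 := sum_resonatorWeight_mul_re_nonneg hS' ((p : ZMod n) * p)
  positivity

/-- The resonance method: the contribution of the principal character is at most
`2 ^ #S * ∑ p ∈ T, w p / φ(n)`. -/
lemma exists_ne_one_le_re_exp_mul_sum {S T : Finset ℕ} (hST : S ⊆ T)
    (hS : ∀ p ∈ S, IsUnit (p : ZMod n)) {w : ℕ → ℝ} (hw : ∀ p ∈ T, 0 ≤ w p) {θ B : ℝ}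
    (hθ : 0 < Real.cos θ) (hB : 0 < B)
    (h : B ≤ Real.cos θ * ((∑ p ∈ S, w p) / 2 - 2 ^ S.card * (∑ p ∈ T, w p) / n.totient)) :
    ∃ χ : DirichletCharacter ℂ n, χ ≠ 1 ∧
      B ≤ (Complex.exp (-(θ : ℂ) * Complex.I) *
        ∑ p ∈ T, χ (p : ZMod n) * (w p : ℂ)).re := by
  let F : DirichletCharacter ℂ n → ℝ := fun χ =>
    (Complex.exp (-(θ : ℂ) * Complex.I) * ∑ p ∈ T, χ (p : ZMod n) * (w p : ℂ)).re
  set A : ℝ := ∑ χ : DirichletCharacter ℂ n, resonatorWeight S χ with hA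
  have hF : ∀ χ, F χ = ∑ p ∈ T, w p *
      (Real.cos θ * (χ (p : ZMod n)).re + Real.sin θ * (χ (p : ZMod n)).im) :=
    re_exp_mul_sum w θ
  by_contra! hcon
  have hφ : 0 < (n.totient : ℝ) := by exact_mod_cast Nat.totient_pos.2 (NeZero.pos n)
  have hA_ge : 2 ^ S.card * (n.totient : ℝ) ≤ A := two_pow_mul_totient_le_sum_resonatorWeight hS
  have h_swap : ∑ χ : DirichletCharacter ℂ n, resonatorWeight S χ * F χ =
      Real.cos θ * ∑ p ∈ T, w p *
        ∑ χ : DirichletCharacter ℂ n, resonatorWeight S χ * (χ (p : ZMod n)).re := by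
    simp only [hF, Finset.mul_sum]
    rw [Finset.sum_comm]
    refine Finset.sum_congr rfl fun p _ => ?_
    have him := sum_resonatorWeight_mul_im hS (p : ZMod n)
    rw [← sub_eq_zero, ← Finset.sum_sub_distrib, ← mul_zero (w p * Real.sin θ), ← him,
      Finset.mul_sum]
    exact Finset.sum_congr rfl fun χ _ => by ring
  have h_lower : Real.cos θ * ((∑ p ∈ S, w p) / 2 * A) ≤
      ∑ χ : DirichletCharacter ℂ n, resonatorWeight S χ * F χ := by
    rw [h_swap]
    refine mul_le_mul_of_nonneg_left ?_ hθ.le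
    rw [div_mul_eq_mul_div, Finset.sum_mul, Finset.sum_div]
    calc ∑ p ∈ S, w p * A / 2
        ≤ ∑ p ∈ S, w p *
          ∑ χ : DirichletCharacter ℂ n, resonatorWeight S χ * (χ (p : ZMod n)).re := by
          refine Finset.sum_le_sum fun p hp => ?_
          rw [mul_div_assoc]
          refine mul_le_mul_of_nonneg_left ?_ (hw p (hST hp))
          linarith [sum_resonatorWeight_le_two_mul hS hp]
      _ ≤ _ := Finset.sum_le_sum_of_subset_of_nonneg hST fun p hp _ =>
          mul_nonneg (hw p hp) (sum_resonatorWeight_mul_re_nonneg hS _)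
  have hF_one : F 1 ≤ Real.cos θ * ∑ p ∈ T, w p := by
    simp only [hF, Finset.mul_sum]
    refine Finset.sum_le_sum fun p hp => ?_
    by_cases hu : IsUnit (p : ZMod n)
    · rw [MulChar.one_apply hu]
      simp [mul_comm]
    · rw [MulChar.map_nonunit _ hu]
      simpa using mul_nonneg hθ.le (hw p hp)
  have h_upper : ∑ χ : DirichletCharacter ℂ n, resonatorWeight S χ * F χ <
      4 ^ S.card * (Real.cos θ * ∑ p ∈ T, w p) + B * A := by
    rw [← Finset.add_sum_erase _ _ (Finset.mem_univ (1 : DirichletCharacter ℂ n)), hA,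
      ← Finset.add_sum_erase _ _ (Finset.mem_univ (1 : DirichletCharacter ℂ n)),
      resonatorWeight_one hS, mul_add]
    have h1 : ∑ χ ∈ Finset.univ.erase (1 : DirichletCharacter ℂ n), resonatorWeight S χ * F χ ≤
        B * ∑ χ ∈ Finset.univ.erase (1 : DirichletCharacter ℂ n), resonatorWeight S χ := by
      rw [Finset.mul_sum]
      refine Finset.sum_le_sum fun χ hχ => ?_
      rw [mul_comm B]
      exact mul_le_mul_of_nonneg_left (hcon χ (Finset.ne_of_mem_erase hχ)).le
        (resonatorWeight_nonneg S χ)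
    have h2 : (4 : ℝ) ^ S.card * F 1 ≤ 4 ^ S.card * (Real.cos θ * ∑ p ∈ T, w p) := by gcongr
    have h3 : 0 < B * 4 ^ S.card := by positivity
    linarith
  have h_principal : 4 ^ S.card * (∑ p ∈ T, w p) ≤
      2 ^ S.card * (∑ p ∈ T, w p) / n.totient * A := by
    rw [div_mul_eq_mul_div, le_div_iff₀ hφ]
    have hT : 0 ≤ ∑ p ∈ T, w p := Finset.sum_nonneg hw
    have h4 : (4 : ℝ) ^ S.card = 2 ^ S.card * 2 ^ S.card := by
      rw [← mul_pow]; norm_num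
    calc (4 : ℝ) ^ S.card * (∑ p ∈ T, w p) * n.totient
        = 2 ^ S.card * (∑ p ∈ T, w p) * (2 ^ S.card * n.totient) := by rw [h4]; ring
      _ ≤ _ := by gcongr
  have hA_nonneg : 0 ≤ A := le_trans (by positivity) hA_ge
  have h5 := mul_le_mul_of_nonneg_right h hA_nonneg
  have h6 := mul_le_mul_of_nonneg_left h_principal hθ.le
  linarith

end

open Filter Real in
lemma eventually_div_four_le_primeCounting :
    ∀ᶠ L : ℝ in atTop, L / 4 ≤ Nat.primeCounting ⌊L * log L⌋₊ := by
  have hx : Tendsto (fun L : ℝ => L * log L) atTop atTop :=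
    tendsto_id.atTop_mul_atTop₀ tendsto_log_atTop
  have hlog : ∀ᶠ x : ℝ in atTop, log (x + 2) ≤ 1 / 20 * (x + 2) := by
    have := (isLittleO_log_id_atTop.comp_tendsto (tendsto_atTop_add_const_right atTop (2 : ℝ)
      tendsto_id)).bound (c := 1 / 20) (by norm_num)
    filter_upwards [this, eventually_ge_atTop 0] with x h h0
    simp only [Function.comp_apply, id, norm_eq_abs] at h
    rw [abs_of_nonneg (a := x + 2) (by linarith)] at h
    exact (le_abs_self _).trans h
  filter_upwards [hx.eventually hlog, hx.eventually_ge_atTop 100, eventually_gt_atTop 1,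
    tendsto_log_atTop.eventually_gt_atTop 1] with L h1 h2 h3 h4
  have hπ := Chebyshev.pi_ge' (x := L * log L) (by linarith)
  refine le_trans ?_ hπ
  have h5 : log (L * log L) ≤ 2 * log L := by
    rw [log_mul (by positivity) (by positivity)]
    linarith [log_le_self (x := log L) (by positivity)]
  rw [le_div_iff₀ (log_pos (by linarith))]
  have h6 : L / 4 * log (L * log L) ≤ L / 4 * (2 * log L) := by gcongr
  nlinarith [log_two_gt_d9]

lemma exists_primes_card_eq {N K : ℕ} (h : K ≤ Nat.primeCounting N) :
    ∃ S ⊆ (Finset.Iic N).filter Nat.Prime, S.card = K := by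
  refine Finset.exists_subset_card_eq (h.trans_eq ?_)
  rw [← Nat.primesLE_card_eq_primeCounting]
  congr 1
  ext p
  simp [Nat.mem_primesLE]

open Filter Real in
lemma eventually_resonance_parameters {σ A : ℝ} (hσ : σ < 1) (hA : 2 ≤ A) :
    ∀ᶠ L : ℝ in atTop, 8 ≤ L ∧ 1 < log L ∧ L * log L ≤ L ^ A ∧ L * log L < exp L ∧
      1 ≤ L ^ (1 - σ) / log L ^ σ ∧ exp (L / 4) * (L ^ A + 1) ≤ (exp L - 1) / 32 := by
  have hr : ∀ᶠ L : ℝ in atTop, log L ^ σ ≤ L ^ (1 - σ) := by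
    filter_upwards [(isLittleO_log_rpow_rpow_atTop σ (sub_pos.2 hσ)).bound one_pos,
      eventually_ge_atTop 1] with L h h1
    rw [one_mul, norm_eq_abs, norm_eq_abs, abs_of_nonneg (a := L ^ (1 - σ)) (by positivity)] at h
    exact (le_abs_self _).trans h
  have he : ∀ᶠ L : ℝ in atTop, L ^ A ≤ exp (1 / 2 * L) := by
    filter_upwards [(isLittleO_rpow_exp_pos_mul_atTop A (b := 1 / 2) (by norm_num)).bound one_pos]
      with L h
    rw [one_mul, norm_eq_abs, norm_eq_abs, abs_of_nonneg (a := exp _) (by positivity)] at h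
    exact (le_abs_self _).trans h
  filter_upwards [eventually_ge_atTop 512, tendsto_log_atTop.eventually_gt_atTop 1, hr, he]
    with L h8 hlog h1 h2
  have hL : 0 < L := by linarith
  have hxA : L * log L ≤ L ^ A := calc
    L * log L ≤ L * L := by gcongr; exact log_le_self hL.le
    _ = L ^ (2 : ℝ) := by rw [rpow_two, sq]
    _ ≤ L ^ A := rpow_le_rpow_of_exponent_le (by linarith) hA
  refine ⟨by linarith, hlog, hxA, ?_, ?_, ?_⟩
  · exact (hxA.trans h2).trans_lt (exp_lt_exp.2 (by linarith))
  · rwa [one_le_div (by positivity)]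
  · have e1 : exp (L / 4) * exp (1 / 2 * L) = exp (L / 4) ^ 3 := by
      rw [← exp_add, ← exp_nat_mul]; congr 1; push_cast; ring
    have e2 : exp L = exp (L / 4) ^ 4 := by
      rw [← exp_nat_mul]; congr 1; push_cast; ring
    have h100 : 128 ≤ exp (L / 4) := by linarith [add_one_le_exp (L / 4)]
    have h3 : exp (L / 4) * (L ^ A + 1) ≤ exp (L / 4) ^ 3 + exp (L / 4) := by
      rw [mul_add, mul_one, ← e1]; gcongr
    rw [e2]
    generalize exp (L / 4) = t at *
    have h4 : 128 * t ^ 3 ≤ t ^ 4 := by nlinarith [pow_pos (show 0 < t by linarith) 3]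
    have h5 : 128 * t ≤ t ^ 2 := by nlinarith
    have h6 : 128 * t ^ 2 ≤ t ^ 3 := by nlinarith [pow_pos (show 0 < t by linarith) 2]
    linarith


/-- For fixed `σ ∈ (1/2, 1)` and `θ ∈ [0, π/2) ∪ (3π/2, 2π]`, there is a
constant `C > 0` (depending only on `σ` and `θ`) such that for all sufficiently large primes
`q` there is a non-principal Dirichlet character `χ` mod `q` with
`Re(e^{-iθ} ∑_{p ≤ Y prime} χ(p) p^{-σ}) ≥ C (log q)^{1-σ} / (log log q)^σ`,
where `Y = (log q)^{100/(σ - 1/2)}`. -/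
theorem large_values_of_twisted_prime_sum (σ θ : ℝ) (hσ : σ ∈ Set.Ioo (1/2 : ℝ) 1)
    (hθ : θ ∈ Set.Ico 0 (Real.pi / 2) ∪ Set.Ioc (3 * Real.pi / 2) (2 * Real.pi)) :
    ∃ C : ℝ, 0 < C ∧ ∃ Q : ℕ, ∀ q : ℕ, q.Prime → Q ≤ q →
      ∃ χ : DirichletCharacter ℂ q, χ ≠ 1 ∧
        C * (Real.log q) ^ (1 - σ) / (Real.log (Real.log q)) ^ σ ≤
          (Complex.exp (-(θ : ℂ) * Complex.I) *
            ∑ p ∈ (Finset.Iic ⌊(Real.log q) ^ (100 / (σ - 1/2))⌋₊).filter Nat.Prime,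
              χ (p : ZMod q) * ((p : ℝ) ^ (-σ) : ℝ)).re := by
  obtain ⟨hσ₀, hσ₁⟩ := hσ
  have hcos : 0 < Real.cos θ := by
    rcases hθ with ⟨h0, h1⟩ | ⟨h0, h1⟩
    · exact Real.cos_pos_of_mem_Ioo ⟨by linarith [Real.pi_pos], h1⟩
    · rw [← Real.cos_sub_two_pi]
      exact Real.cos_pos_of_mem_Ioo ⟨by linarith, by linarith [Real.pi_pos]⟩
  have hA : 2 ≤ 100 / (σ - 1 / 2) := by
    rw [le_div_iff₀ (by linarith)]; linarith
  refine ⟨Real.cos θ / 32, by positivity, ?_⟩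
  obtain ⟨Q, hQ⟩ := Filter.eventually_atTop.1
    ((Real.tendsto_log_atTop.comp tendsto_natCast_atTop_atTop).eventually
      (eventually_div_four_le_primeCounting.and (eventually_resonance_parameters hσ₁ hA)))
  refine ⟨Q, fun q hq hQq => ?_⟩
  have : NeZero q := ⟨hq.ne_zero⟩
  have hq0 : (0 : ℝ) < q := by exact_mod_cast hq.pos
  obtain ⟨hπ, hL8, hloglog, hxY, hxq, hT, htail⟩ := hQ q hQq
  simp only [Function.comp_apply] at hπ hL8 hloglog hxY hxq hT htail
  rw [Real.exp_log hq0] at hxq htail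
  set L := Real.log q
  set Y := L ^ (100 / (σ - 1 / 2))
  have hL0 : 0 < L := by linarith
  have hx0 : 0 < L * Real.log L := by positivity
  obtain ⟨S, hS, hcard⟩ := exists_primes_card_eq (N := ⌊L * Real.log L⌋₊) (K := ⌊L / 4⌋₊)
    (Nat.cast_le (α := ℝ).1 ((Nat.floor_le (by positivity)).trans hπ))
  have hS_le : ∀ p ∈ S, p.Prime ∧ (p : ℝ) ≤ L * Real.log L := fun p hp => by
    obtain ⟨h1, h2⟩ := Finset.mem_filter.1 (hS hp)
    exact ⟨h2, (Nat.le_floor_iff hx0.le).1 (Finset.mem_Iic.1 h1)⟩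
  have hST : S ⊆ (Finset.Iic ⌊Y⌋₊).filter Nat.Prime :=
    hS.trans (Finset.filter_subset_filter _ (Finset.Iic_subset_Iic.2 (Nat.floor_le_floor hxY)))
  have hS_unit : ∀ p ∈ S, IsUnit (p : ZMod q) := fun p hp => by
    rw [ZMod.isUnit_iff_coprime]
    obtain ⟨h1, h2⟩ := hS_le p hp
    exact (Nat.coprime_primes h1 hq).2 (Nat.cast_lt (α := ℝ).1 (h2.trans_lt hxq)).ne
  have h_main : L ^ (1 - σ) / Real.log L ^ σ / 8 ≤ ∑ p ∈ S, (p : ℝ) ^ (-σ) := calc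
    L ^ (1 - σ) / Real.log L ^ σ / 8 = L / 8 * (L * Real.log L) ^ (-σ) := by
      rw [Real.mul_rpow hL0.le (by linarith), Real.rpow_sub hL0, Real.rpow_one,
        Real.rpow_neg hL0.le, Real.rpow_neg (by linarith)]
      ring
    _ ≤ S.card * (L * Real.log L) ^ (-σ) := by
      gcongr
      rw [hcard]
      linarith [Nat.lt_floor_add_one (L / 4)]
    _ ≤ ∑ p ∈ S, (p : ℝ) ^ (-σ) := by
      rw [← nsmul_eq_mul]
      refine Finset.card_nsmul_le_sum _ _ _ fun p hp => ?_
      obtain ⟨h1, h2⟩ := hS_le p hp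
      exact Real.rpow_le_rpow_of_nonpos (by exact_mod_cast h1.pos) h2 (by linarith)
  have h_sum : ∑ p ∈ (Finset.Iic ⌊Y⌋₊).filter Nat.Prime, (p : ℝ) ^ (-σ) ≤ Y + 1 := calc
    _ ≤ ((Finset.Iic ⌊Y⌋₊).filter Nat.Prime).card • (1 : ℝ) :=
      Finset.sum_le_card_nsmul _ _ _ fun p hp =>
        Real.rpow_le_one_of_one_le_of_nonpos
          (by exact_mod_cast (Finset.mem_filter.1 hp).2.one_le) (by linarith)
    _ ≤ (⌊Y⌋₊ : ℝ) + 1 := by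
      rw [nsmul_eq_mul, mul_one]
      exact_mod_cast (Finset.card_filter_le _ _).trans_eq (Nat.card_Iic _)
    _ ≤ Y + 1 := by gcongr; exact Nat.floor_le (by positivity)
  have h_pow : (2 : ℝ) ^ S.card ≤ Real.exp (L / 4) := calc
    (2 : ℝ) ^ S.card ≤ Real.exp 1 ^ S.card := by
      gcongr; linarith [Real.add_one_le_exp 1]
    _ ≤ Real.exp (L / 4) := by
      rw [← Real.exp_nat_mul, mul_one, hcard]
      exact Real.exp_le_exp.2 (Nat.floor_le (by positivity))
  have h_err : 2 ^ S.card * (∑ p ∈ (Finset.Iic ⌊Y⌋₊).filter Nat.Prime, (p : ℝ) ^ (-σ)) /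
      q.totient ≤ 1 / 32 := by
    rw [Nat.totient_prime hq, Nat.cast_sub hq.one_le, Nat.cast_one]
    have hq1 : (0 : ℝ) < q - 1 := sub_pos.2 (by exact_mod_cast hq.one_lt)
    rw [div_le_iff₀ hq1]
    calc _ ≤ Real.exp (L / 4) * (Y + 1) := by gcongr
      _ ≤ _ := by linarith
  refine exists_ne_one_le_re_exp_mul_sum (w := fun p => (p : ℝ) ^ (-σ)) hST hS_unit
    (fun p _ => by positivity) hcos (by positivity) ?_
  calc Real.cos θ / 32 * L ^ (1 - σ) / Real.log L ^ σ
      = Real.cos θ * (L ^ (1 - σ) / Real.log L ^ σ / 32) := by ring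
    _ ≤ _ := by
      gcongr
      linarith
end

section
/- Let σ ∈ (1/2, 1) be fixed and let θ ∈ [0, π/2) ∪ (3π/2, 2π] (so that cos θ > 0). There exists a constant c > 0 depending only on σ and θ such that for all sufficiently large prime numbers q there is a non-principal Dirichlet character χ modulo q with L(σ, χ) ≠ 0 and −Re( e^{−iθ} · L′(σ, χ)/L(σ, χ) ) ≥ c · (log q)^{1−σ} (log log q)^{1−σ}. -/
open Finset in
theorem tsum_sub_le_of_antitoneOn {f : ℝ → ℝ} {q a : ℝ} (hq : 0 ≤ q) (ha : 0 ≤ a) (haq : a ≤ q)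
    (hf : AntitoneOn f (Set.Ici q)) (hf0 : ∀ x ∈ Set.Ici q, 0 ≤ f x) :
    0 ≤ ∑' k : ℕ, (f (a + (k + 1) * q) - f ((k + 2) * q)) ∧
      ∑' k : ℕ, (f (a + (k + 1) * q) - f ((k + 2) * q)) ≤ f q := by
  have hkq (k : ℕ) : 0 ≤ (k : ℝ) * q := by positivity
  have hterm (k : ℕ) : 0 ≤ f (a + (k + 1) * q) - f ((k + 2) * q) := by
    have := hkq k
    exact sub_nonneg.2 <| hf (Set.mem_Ici.2 (by linarith)) (Set.mem_Ici.2 (by linarith))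
      (by linarith)
  refine ⟨tsum_nonneg hterm, Real.tsum_le_of_sum_range_le hterm fun n ↦ ?_⟩
  calc ∑ k ∈ range n, (f (a + (k + 1) * q) - f ((k + 2) * q))
      ≤ ∑ k ∈ range n, (f (((k : ℕ) + 1) * q) - f (((k + 1 : ℕ) + 1) * q)) := by
        refine sum_le_sum fun k _ ↦ ?_
        have := hkq k
        have h1 : f (a + (k + 1) * q) ≤ f ((k + 1) * q) :=
          hf (Set.mem_Ici.2 (by linarith)) (Set.mem_Ici.2 (by linarith)) (by linarith)
        push_cast
        rw [show (k : ℝ) + 1 + 1 = k + 2 by ring]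
        linarith
    _ = f q - f ((n + 1) * q) := by
        rw [sum_range_sub' (fun k : ℕ ↦ f ((k + 1) * q))]
        simp
    _ ≤ f q := by
        have := hf0 ((n + 1) * q) (Set.mem_Ici.2 (by have := hkq n; linarith))
        linarith

theorem norm_ofReal_cpow_sub_le {m x y : ℝ} (hm : 0 < m) (hx : m ≤ x) (hy : m ≤ y) {s : ℂ}
    (hs : -1 ≤ s.re) :
    ‖(x : ℂ) ^ (-s) - (y : ℂ) ^ (-s)‖ ≤ ‖s‖ * m ^ (-s.re - 1) * |x - y| := by
  rcases eq_or_ne s 0 with rfl | hs0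
  · simp
  have key := Convex.norm_image_sub_le_of_norm_hasDerivWithin_le (𝕜 := ℝ)
    (f := fun t : ℝ ↦ (t : ℂ) ^ (-s)) (f' := fun t : ℝ ↦ -s * (t : ℂ) ^ (-s - 1))
    (s := Set.Ici m) (C := ‖s‖ * m ^ (-s.re - 1)) (x := y) (y := x) ?_ ?_ (convex_Ici m) hy hx
  · simpa using key
  · intro t ht
    have ht0 : 0 < t := hm.trans_le ht
    exact hasDerivAt_ofReal_cpow_const ht0.ne' (neg_ne_zero.2 hs0)
      |>.hasDerivWithinAt
  · intro t ht
    have ht0 : 0 < t := hm.trans_le ht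
    rw [norm_mul, norm_neg, Complex.norm_cpow_eq_rpow_re_of_pos ht0]
    have : (-s - 1).re = -s.re - 1 := by simp
    rw [this]
    gcongr ‖s‖ * ?_
    exact Real.rpow_le_rpow_of_nonpos hm ht (by linarith)

/-- The `k`-th term of the series by which the contribution of the residue class `a` modulo `q` to
`L(s, χ)`, apart from its first term `a ^ (-s)`, is continued to `0 < Re s`. -/
noncomputable def tailTerm (q a k : ℕ) (s : ℂ) : ℂ :=
  ((a + (k + 1) * q : ℝ) : ℂ) ^ (-s) - (((k + 2) * q : ℝ) : ℂ) ^ (-s)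

theorem sum_zmod_eq_sum_range {M : Type*} [AddCommMonoid M] (q : ℕ) [NeZero q] (f : ZMod q → M) :
    ∑ j, f j = ∑ a ∈ Finset.range q, f a := by
  refine Finset.sum_nbij' (fun j ↦ j.val) (fun a ↦ (a : ZMod q)) ?_ ?_ ?_ ?_ ?_
  · exact fun j _ ↦ Finset.mem_range.2 j.val_lt
  · simp
  · simp
  · exact fun a ha ↦ ZMod.val_cast_of_lt (Finset.mem_range.1 ha)
  · simp

theorem hasSum_residueClass {q a : ℕ} [NeZero q] (ha0 : 0 < a) (haq : a < q) {s : ℂ}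
    (hs : 1 < s.re) :
    HasSum (fun k : ℕ ↦ ((a + k * q : ℝ) : ℂ) ^ (-s))
      ((q : ℂ) ^ (-s) * HurwitzZeta.hurwitzZeta (ZMod.toAddCircle (a : ZMod q)) s) := by
  have hq0 : (0 : ℝ) < q := by exact_mod_cast NeZero.pos q
  have hmem : (a / q : ℝ) ∈ Set.Icc 0 1 :=
    ⟨by positivity, (div_le_one hq0).2 (by exact_mod_cast haq.le)⟩
  have h := (HurwitzZeta.hasSum_hurwitzZeta_of_one_lt_re hmem hs).mul_left ((q : ℂ) ^ (-s))
  rw [ZMod.toAddCircle_apply, ZMod.val_cast_of_lt haq]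
  convert! h using 2 with k
  have h2 : (0 : ℝ) ≤ k + a / q := by positivity
  have h1 : ((a + k * q : ℝ) : ℂ) = ((q : ℝ) : ℂ) * ((k + a / q : ℝ) : ℂ) := by
    rw [← Complex.ofReal_mul, mul_add, mul_div_cancel₀ _ hq0.ne', mul_comm, add_comm]
  rw [h1, Complex.mul_cpow_ofReal_nonneg hq0.le h2, one_div, ← Complex.cpow_neg]
  simp

theorem summable_mul_cpow {q : ℕ} [NeZero q] {s : ℂ} (hs : 1 < s.re) :
    Summable fun k : ℕ ↦ (((k + 2) * q : ℝ) : ℂ) ^ (-s) := by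
  have hq0 : (0 : ℝ) < q := by exact_mod_cast NeZero.pos q
  have h : Summable fun k : ℕ ↦ ((k + 2 : ℕ) : ℂ) ^ (-s) := by
    have := (summable_nat_add_iff 2).2 (Complex.summable_one_div_nat_cpow.2 hs)
    simpa [Complex.cpow_neg] using this
  convert! h.mul_right ((q : ℂ) ^ (-s)) using 2 with k
  rw [Complex.ofReal_mul, Complex.mul_cpow_ofReal_nonneg (by positivity) hq0.le]
  simp

theorem LFunction_eq_sum_of_one_lt_re {q : ℕ} [NeZero q] {χ : DirichletCharacter ℂ q} (hχ : χ ≠ 1)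
    (hq : 1 < q) {s : ℂ} (hs : 1 < s.re) :
    χ.LFunction s = ∑ a ∈ Finset.range q, χ a * ((a : ℂ) ^ (-s) + ∑' k, tailTerm q a k s) := by
  have hsum : ∑ a ∈ Finset.range q, χ a = 0 := by
    rw [← sum_zmod_eq_sum_range q fun j ↦ χ j]
    exact χ.sum_eq_zero_of_ne_one hχ
  have : Fact (1 < q) := ⟨hq⟩
  rw [DirichletCharacter.LFunction, ZMod.LFunction, sum_zmod_eq_sum_range q, Finset.mul_sum,
    ← sub_zero (∑ a ∈ Finset.range q, _),
    show (0 : ℂ) = ∑ a ∈ Finset.range q, χ a * ∑' k : ℕ, (((k + 2) * q : ℝ) : ℂ) ^ (-s) by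
      rw [← Finset.sum_mul, hsum, zero_mul], ← Finset.sum_sub_distrib]
  refine Finset.sum_congr rfl fun a ha ↦ ?_
  rcases Nat.eq_zero_or_pos a with rfl | ha0
  · simp [MulChar.map_zero χ]
  have h := hasSum_residueClass ha0 (Finset.mem_range.1 ha) hs
  have h' := (hasSum_nat_add_iff' 1).2 h
  have h'' := (h'.sub (summable_mul_cpow (q := q) hs).hasSum).tsum_eq
  have hE : ∑' k, tailTerm q a k s = ∑' k : ℕ, (((a + (k + 1 : ℕ) * q : ℝ) : ℂ) ^ (-s) -
      (((k + 2) * q : ℝ) : ℂ) ^ (-s)) := by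
    simp [tailTerm]
  rw [hE, h'']
  simp
  ring

theorem norm_tailTerm_le {q a k : ℕ} (hq : 0 < q) (ha : a < q) {s : ℂ} (hs : -1 ≤ s.re) :
    ‖tailTerm q a k s‖ ≤ ‖s‖ * ((k + 1) * q) ^ (-s.re - 1) * q := by
  have hq0 : (0 : ℝ) < q := by exact_mod_cast hq
  have haq : (a : ℝ) ≤ q := by exact_mod_cast ha.le
  have ha0 : (0 : ℝ) ≤ a := by positivity
  refine (norm_ofReal_cpow_sub_le (m := (k + 1) * q) (by positivity) (by linarith) (by linarith)
    hs).trans ?_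
  gcongr
  rw [abs_le]
  constructor <;> linarith

/-- A convex neighbourhood of `2` and of `σ` on which the tails converge uniformly. -/
def continuationDomain (σ : ℝ) : Set ℂ := {s | σ / 2 < s.re} ∩ Metric.ball 0 3

theorem isOpen_continuationDomain (σ : ℝ) : IsOpen (continuationDomain σ) :=
  (isOpen_lt continuous_const Complex.continuous_re).inter Metric.isOpen_ball

theorem convex_continuationDomain (σ : ℝ) : Convex ℝ (continuationDomain σ) :=
  (convex_halfSpace_re_gt _).inter (convex_ball _ _)

theorem differentiable_tailTerm {q a k : ℕ} (hq : 0 < q) : Differentiable ℂ (tailTerm q a k) := by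
  have hq0 : (0 : ℝ) < q := by exact_mod_cast hq
  have h1 : ((a + (k + 1) * q : ℝ) : ℂ) ≠ 0 := by
    rw [Complex.ofReal_ne_zero]; positivity
  have h2 : (((k + 2) * q : ℝ) : ℂ) ≠ 0 := by
    rw [Complex.ofReal_ne_zero]; positivity
  intro s
  unfold tailTerm
  exact (differentiableAt_id.neg.const_cpow (Or.inl h1)).sub
    (differentiableAt_id.neg.const_cpow (Or.inl h2))

theorem tailTerm_majorant {q a : ℕ} {σ : ℝ} (hσ : 0 < σ) (hq : 0 < q) (ha : a < q) :
    ∃ u : ℕ → ℝ, Summable u ∧ ∀ k, ∀ s ∈ continuationDomain σ, ‖tailTerm q a k s‖ ≤ u k := by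
  have hq1 : (1 : ℝ) ≤ q := by exact_mod_cast hq
  refine ⟨fun k ↦ 3 * ((k + 1) * q) ^ (-(σ / 2) - 1) * q, ?_, fun k s hs ↦ ?_⟩
  · have h : Summable fun k : ℕ ↦ ((k + 1 : ℕ) : ℝ) ^ (-(σ / 2) - 1) :=
      (summable_nat_add_iff 1).2 (Real.summable_nat_rpow.2 (by linarith))
    convert! h.mul_left (3 * (q : ℝ) ^ (-(σ / 2) - 1) * q) using 2 with k
    rw [Real.mul_rpow (by positivity) (by positivity)]
    push_cast
    ring
  · have h1 : σ / 2 < s.re := hs.1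
    have h2 : ‖s‖ ≤ 3 := by simpa using (Metric.mem_ball.1 hs.2).le
    refine (norm_tailTerm_le hq ha (by linarith)).trans ?_
    have hk : (1 : ℝ) ≤ (k + 1) * q := one_le_mul_of_one_le_of_one_le (by simp) hq1
    refine mul_le_mul_of_nonneg_right (mul_le_mul h2 ?_ (by positivity) (by norm_num))
      (by positivity)
    exact Real.rpow_le_rpow_of_exponent_le hk (by linarith)

theorem LFunction_eq_sum {q : ℕ} [NeZero q] {χ : DirichletCharacter ℂ q} (hχ : χ ≠ 1)
    (hq : 1 < q) {σ : ℝ} (hσ : σ ∈ Set.Ioo (0 : ℝ) 1) :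
    Set.EqOn χ.LFunction
      (fun s ↦ ∑ a ∈ Finset.range q, χ a * ((a : ℂ) ^ (-s) + ∑' k, tailTerm q a k s))
      (continuationDomain σ) := by
  have : Fact (1 < q) := ⟨hq⟩
  have hopen := isOpen_continuationDomain σ
  have h2mem : (2 : ℂ) ∈ continuationDomain σ := by
    constructor
    · simpa using (by linarith [hσ.2] : σ / 2 < 2)
    · simp; norm_num
  refine AnalyticOnNhd.eqOn_of_preconnected_of_eventuallyEq (𝕜 := ℂ) (z₀ := 2) ?_ ?_
    (convex_continuationDomain σ).isPreconnected h2mem ?_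
  · exact (DirichletCharacter.differentiable_LFunction hχ).differentiableOn.analyticOnNhd hopen
  · suffices h : DifferentiableOn ℂ _ _ from h.analyticOnNhd hopen
    refine DifferentiableOn.fun_sum fun a ha ↦ ?_
    rcases Nat.eq_zero_or_pos a with rfl | ha0
    · simp [MulChar.map_zero χ]
    obtain ⟨u, hu, hle⟩ := tailTerm_majorant hσ.1 (by lia) (Finset.mem_range.1 ha)
    refine (DifferentiableOn.add (𝕜 := ℂ) (fun s _ ↦ DifferentiableAt.differentiableWithinAt ?_)
      (Complex.differentiableOn_tsum_of_summable_norm hu (fun k ↦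
        (differentiable_tailTerm (by lia)).differentiableOn) hopen hle)).const_mul _
    exact differentiableAt_id.neg.const_cpow (Or.inl (by exact_mod_cast ha0.ne'))
  · have : {s : ℂ | 1 < s.re} ∈ nhds (2 : ℂ) :=
      (isOpen_lt continuous_const Complex.continuous_re).mem_nhds (by simp)
    filter_upwards [this] with s hs using LFunction_eq_sum_of_one_lt_re hχ hq hs

theorem hasDerivAt_ofReal_cpow_neg {x : ℝ} (hx : 0 < x) (σ : ℝ) :
    HasDerivAt (fun s : ℂ ↦ (x : ℂ) ^ (-s)) (-(Real.log x * x ^ (-σ) : ℝ) : ℂ) (σ : ℂ) := by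
  have h := (hasDerivAt_id (σ : ℂ)).neg.const_cpow (c := (x : ℂ))
    (Or.inl (Complex.ofReal_ne_zero.2 hx.ne'))
  convert! h using 1
  simp only [Pi.neg_apply, id]
  rw [← Complex.ofReal_neg σ, ← Complex.ofReal_cpow hx.le, ← Complex.ofReal_log hx.le]
  push_cast
  ring

theorem exists_nonneg_coefficients {σ : ℝ} (hσ : σ ∈ Set.Ioo (0 : ℝ) 1) {q : ℕ} [NeZero q]
    (hq : 1 < q) (hqσ : Real.exp σ⁻¹ ≤ q) :
    ∃ e e' : ℕ → ℝ, (∀ a < q, 0 ≤ e a ∧ e a ≤ (q : ℝ) ^ (-σ)) ∧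
      (∀ a < q, 0 ≤ e' a ∧ e' a ≤ Real.log q * (q : ℝ) ^ (-σ)) ∧
      ∀ χ : DirichletCharacter ℂ q, χ ≠ 1 →
        χ.LFunction σ = ∑ a ∈ Finset.range q, ((a : ℝ) ^ (-σ) + e a : ℝ) * χ a ∧
        deriv χ.LFunction σ =
          -∑ a ∈ Finset.range q, (Real.log a * (a : ℝ) ^ (-σ) + e' a : ℝ) * χ a := by
  have : Fact (1 < q) := ⟨hq⟩
  have hq1 : (1 : ℝ) ≤ q := by exact_mod_cast hq.le
  have hq0 : (0 : ℝ) < q := by linarith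
  refine ⟨fun a ↦ ∑' k : ℕ, ((a + (k + 1) * q : ℝ) ^ (-σ) - ((k + 2) * q : ℝ) ^ (-σ)),
    fun a ↦ ∑' k : ℕ, (Real.log (a + (k + 1) * q) * (a + (k + 1) * q : ℝ) ^ (-σ) -
      Real.log ((k + 2) * q) * ((k + 2) * q : ℝ) ^ (-σ)), fun a ha ↦ ?_, fun a ha ↦ ?_,
    fun χ hχ ↦ ?_⟩
  · refine tsum_sub_le_of_antitoneOn (f := fun x ↦ x ^ (-σ)) hq0.le (by positivity)
      (by exact_mod_cast ha.le) (fun x hx y _ hxy ↦ ?_) fun x hx ↦ ?_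
    · exact Real.rpow_le_rpow_of_nonpos (hq0.trans_le hx) hxy (by linarith [hσ.1])
    · exact Real.rpow_nonneg (hq0.le.trans hx) _
  · refine tsum_sub_le_of_antitoneOn (f := fun x ↦ Real.log x * x ^ (-σ)) hq0.le (by positivity)
      (by exact_mod_cast ha.le) (fun x hx y hy hxy ↦ ?_) fun x hx ↦ ?_
    · have h := Real.log_div_self_rpow_antitoneOn hσ.1 (Set.mem_Ici.2 (hqσ.trans hx))
        (Set.mem_Ici.2 (hqσ.trans hy)) hxy
      simpa only [Real.rpow_neg (hq0.le.trans hx), Real.rpow_neg (hq0.le.trans hy),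
        ← div_eq_mul_inv] using h
    · exact mul_nonneg (Real.log_nonneg (hq1.trans hx)) (Real.rpow_nonneg (hq0.le.trans hx) _)
  have hopen := isOpen_continuationDomain σ
  have hmem : (σ : ℂ) ∈ continuationDomain σ := by
    constructor
    · simpa using hσ.1
    · simpa [abs_of_pos hσ.1] using hσ.2.trans (by norm_num)
  have heq := LFunction_eq_sum hχ hq hσ
  constructor
  · rw [heq hmem]
    refine Finset.sum_congr rfl fun a _ ↦ ?_
    rw [mul_comm]
    congr 1
    rw [Complex.ofReal_add, Complex.ofReal_cpow (by positivity), Complex.ofReal_tsum]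
    congr 1
    · simp
    refine tsum_congr fun k ↦ ?_
    rw [tailTerm, Complex.ofReal_sub, Complex.ofReal_cpow (by positivity),
      Complex.ofReal_cpow (by positivity), Complex.ofReal_neg]
  · rw [Filter.EventuallyEq.deriv_eq (heq.eventuallyEq_of_mem (hopen.mem_nhds hmem)),
      ← Finset.sum_neg_distrib]
    refine HasDerivAt.deriv (HasDerivAt.fun_sum fun a ha ↦ ?_)
    rcases Nat.eq_zero_or_pos a with rfl | ha0
    · simpa [MulChar.map_zero χ] using hasDerivAt_const (σ : ℂ) (0 : ℂ)
    obtain ⟨u, hu, hle⟩ := tailTerm_majorant hσ.1 (by lia) (Finset.mem_range.1 ha)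
    have hdiff (k : ℕ) : DifferentiableOn ℂ (tailTerm q a k) (continuationDomain σ) :=
      (differentiable_tailTerm (by lia)).differentiableOn
    have hsum := Complex.hasSum_deriv_of_summable_norm hu hdiff hopen hle hmem
    have hd := ((Complex.differentiableOn_tsum_of_summable_norm hu hdiff hopen hle).differentiableAt
      (hopen.mem_nhds hmem)).hasDerivAt
    rw [← hsum.tsum_eq] at hd
    have ha0' : (0 : ℝ) < a := by exact_mod_cast ha0
    have h1 := hasDerivAt_ofReal_cpow_neg ha0' σ
    rw [Complex.ofReal_natCast] at h1
    refine ((h1.add hd).const_mul (χ a)).congr_deriv ?_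
    rw [neg_mul_eq_neg_mul, mul_comm]
    congr 1
    rw [Complex.ofReal_add, neg_add, Complex.ofReal_tsum, ← tsum_neg]
    congr 1
    refine tsum_congr fun k ↦ ?_
    have h2 : HasDerivAt (tailTerm q a k) _ (σ : ℂ) :=
      (hasDerivAt_ofReal_cpow_neg (x := a + (k + 1) * q) (by positivity) σ).sub
      (hasDerivAt_ofReal_cpow_neg (x := (k + 2) * q) (by positivity) σ)
    rw [h2.deriv]
    push_cast
    ring

/-- The cone of functions on the characters modulo `q` all of whose Fourier coefficients are
nonnegative. -/
noncomputable def positiveCone (q : ℕ) : Subsemiring (DirichletCharacter ℂ q → ℂ) :=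
  Submonoid.subsemiringClosure
    { carrier := {F | ∃ c : ℝ, 0 ≤ c ∧ ∃ a : ZMod q, F = fun χ ↦ (c : ℂ) * χ a}
      one_mem' := ⟨1, zero_le_one, 1, by ext; simp⟩
      mul_mem' := by
        rintro _ _ ⟨c, hc, a, rfl⟩ ⟨d, hd, b, rfl⟩
        refine ⟨c * d, mul_nonneg hc hd, a * b, ?_⟩
        ext χ
        simp only [Pi.mul_apply, map_mul, Complex.ofReal_mul]
        ring }

namespace positiveCone

variable {q : ℕ}

theorem monomial_mem {c : ℝ} (hc : 0 ≤ c) (a : ZMod q) :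
    (fun χ : DirichletCharacter ℂ q ↦ (c : ℂ) * χ a) ∈ positiveCone q :=
  (Submonoid.subsemiringClosure_mem _).2 <| AddSubmonoid.subset_closure ⟨c, hc, a, rfl⟩

theorem const_mem {c : ℝ} (hc : 0 ≤ c) :
    (fun _ : DirichletCharacter ℂ q ↦ (c : ℂ)) ∈ positiveCone q := by
  simpa using monomial_mem (q := q) hc 1

theorem eval_mem (a : ZMod q) : (fun χ : DirichletCharacter ℂ q ↦ χ a) ∈ positiveCone q := by
  simpa using monomial_mem (q := q) zero_le_one a

theorem sum_mem {ι : Type*} (s : Finset ι) {c : ι → ℝ} (hc : ∀ i ∈ s, 0 ≤ c i)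
    (a : ι → ZMod q) :
    (fun χ : DirichletCharacter ℂ q ↦ ∑ i ∈ s, (c i : ℂ) * χ (a i)) ∈ positiveCone q := by
  have h := _root_.sum_mem (S := positiveCone q) fun i hi ↦ monomial_mem (hc i hi) (a i)
  convert! h using 1
  ext χ
  simp

theorem cone_induction {p : (DirichletCharacter ℂ q → ℂ) → Prop} {F : DirichletCharacter ℂ q → ℂ}
    (hF : F ∈ positiveCone q)
    (monomial : ∀ (c : ℝ) (_ : 0 ≤ c) (a : ZMod q), p fun χ ↦ (c : ℂ) * χ a)
    (zero : p 0) (add : ∀ F G, p F → p G → p (F + G)) : p F := by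
  refine AddSubmonoid.closure_induction (motive := fun F _ ↦ p F) ?_ zero
    (fun F G _ _ ↦ add F G) ((Submonoid.subsemiringClosure_mem _).1 hF)
  rintro _ ⟨c, hc, a, rfl⟩
  exact monomial c hc a

theorem star_mem [NeZero q] {F : DirichletCharacter ℂ q → ℂ} (hF : F ∈ positiveCone q) :
    star F ∈ positiveCone q := by
  refine cone_induction (p := fun F ↦ star F ∈ positiveCone q) hF (fun c hc a ↦ ?_) (by simp) fun F G hF hG ↦ ?_
  · convert! monomial_mem hc (Ring.inverse a) using 1
    ext χ
    rw [← MulChar.inv_apply, ← MulChar.star_apply', Pi.star_apply, star_mul', Complex.star_def,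
      Complex.conj_ofReal]
  · rw [star_add]
    exact add_mem hF hG

theorem exists_sum_eq [NeZero q] {F : DirichletCharacter ℂ q → ℂ} (hF : F ∈ positiveCone q) :
    ∃ t : ℝ, 0 ≤ t ∧ ∑ χ, F χ = t := by
  refine cone_induction (p := fun F ↦ ∃ t : ℝ, 0 ≤ t ∧ ∑ χ, F χ = t) hF (fun c hc a ↦ ?_)
    ⟨0, le_rfl, by simp⟩ ?_
  · rw [← Finset.mul_sum, DirichletCharacter.sum_characters_eq]
    split_ifs
    · exact ⟨c * q.totient, by positivity, by push_cast; rfl⟩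
    · exact ⟨0, le_rfl, by simp⟩
  · rintro F G ⟨t, ht, hFt⟩ ⟨u, hu, hGu⟩
    exact ⟨t + u, add_nonneg ht hu, by simp [Finset.sum_add_distrib, hFt, hGu]⟩

theorem inv_one_sub_mem [NeZero q] {r : ℝ} (hr0 : 0 ≤ r) (hr1 : r < 1) {a : ZMod q}
    (ha : IsUnit a) :
    (fun χ : DirichletCharacter ℂ q ↦ (1 - (r : ℂ) * χ a)⁻¹) ∈ positiveCone q := by
  obtain ⟨u, rfl⟩ := ha
  set n := q.totient
  have hn : n ≠ 0 := (Nat.totient_pos.2 (NeZero.pos q)).ne'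
  have hrn : r ^ n < 1 := pow_lt_one₀ hr0 hr1 hn
  have hmem := mul_mem (const_mem (q := q) (inv_nonneg.2 (sub_nonneg.2 hrn.le)))
    (_root_.sum_mem (S := positiveCone q) (t := Finset.range n) fun j _ ↦
      pow_mem (monomial_mem hr0 (u : ZMod q)) j)
  convert! hmem using 1
  ext χ
  have hz : χ u ^ n = 1 := by
    rw [← map_pow, ← Units.val_pow_eq_pow_val, ZMod.pow_totient]
    simp
  have hgeom := mul_neg_geom_sum ((r : ℂ) * χ u) n
  rw [mul_pow, hz, mul_one] at hgeom
  have hne : (1 : ℂ) - (r : ℂ) ^ n ≠ 0 := by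
    have : (1 - r ^ n : ℝ) ≠ 0 := by linarith
    exact_mod_cast this
  have hne' : 1 - (r : ℂ) * χ u ≠ 0 := by
    intro h
    rw [h, zero_mul] at hgeom
    exact hne hgeom.symm
  simp only [Pi.mul_apply, Finset.sum_apply, Pi.pow_apply, Complex.ofReal_inv, Complex.ofReal_sub,
    Complex.ofReal_one, Complex.ofReal_pow]
  rw [← hgeom, mul_inv, mul_assoc, inv_mul_cancel₀, mul_one]
  intro h
  rw [h, mul_zero] at hgeom
  exact hne hgeom.symm

end positiveCone

/-- The squared modulus of `∏ p ∈ P, (1 - χ p / 2)⁻¹`. -/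
noncomputable def resonator {q : ℕ} (P : Finset ℕ) (χ : DirichletCharacter ℂ q) : ℝ :=
  ∏ p ∈ P, (‖1 - χ p / 2‖ ^ 2)⁻¹

theorem resonator_nonneg {q : ℕ} (P : Finset ℕ) (χ : DirichletCharacter ℂ q) :
    0 ≤ resonator P χ :=
  Finset.prod_nonneg fun _ _ ↦ by positivity

theorem norm_one_sub_half_bounds {z : ℂ} (hz : ‖z‖ ≤ 1) :
    1 / 2 ≤ ‖1 - z / 2‖ ∧ ‖1 - z / 2‖ ≤ 2 := by
  have h : ‖z / 2‖ ≤ 1 / 2 := by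
    rw [norm_div, Complex.norm_ofNat]
    linarith
  have h1 := norm_sub_norm_le 1 (z / 2)
  have h2 := norm_sub_le 1 (z / 2)
  rw [norm_one] at h1 h2
  constructor <;> linarith

theorem resonator_le {q : ℕ} (P : Finset ℕ) (χ : DirichletCharacter ℂ q) :
    resonator P χ ≤ 4 ^ P.card := by
  rw [resonator, ← Finset.prod_const]
  refine Finset.prod_le_prod (fun _ _ ↦ by positivity) fun p _ ↦ ?_
  have h := (norm_one_sub_half_bounds (χ.norm_le_one p)).1
  rw [inv_le_comm₀ (by positivity) (by norm_num)]
  nlinarith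

theorem inv_le_resonator {q : ℕ} (P : Finset ℕ) (χ : DirichletCharacter ℂ q) :
    (4 ^ P.card : ℝ)⁻¹ ≤ resonator P χ := by
  rw [← inv_pow, resonator, ← Finset.prod_const]
  refine Finset.prod_le_prod (fun _ _ ↦ by norm_num) fun p _ ↦ ?_
  obtain ⟨h, h'⟩ := norm_one_sub_half_bounds (χ.norm_le_one p)
  gcongr
  nlinarith

theorem resonator_mem_positiveCone {q : ℕ} [NeZero q] {P : Finset ℕ}
    (hP : ∀ p ∈ P, p.Coprime q) :
    (fun χ : DirichletCharacter ℂ q ↦ (resonator P χ : ℂ)) ∈ positiveCone q := by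
  have h := prod_mem (S := positiveCone q) (t := P) fun p hp ↦
    mul_mem (positiveCone.inv_one_sub_mem (r := 1 / 2) (by norm_num) (by norm_num)
      ((ZMod.isUnit_iff_coprime p q).2 (hP p hp)))
      (positiveCone.star_mem (positiveCone.inv_one_sub_mem (r := 1 / 2) (by norm_num)
        (by norm_num) ((ZMod.isUnit_iff_coprime p q).2 (hP p hp))))
  convert! h using 1
  ext χ
  rw [resonator, Complex.ofReal_prod, Finset.prod_apply]
  refine Finset.prod_congr rfl fun p _ ↦ ?_
  rw [Pi.mul_apply, Pi.star_apply, Complex.star_def, Complex.mul_conj, Complex.normSq_eq_norm_sq,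
    norm_inv, inv_pow]
  congr 4
  push_cast
  ring_nf

theorem eval_sub_half_mul_resonator_mem {q : ℕ} [NeZero q] {P : Finset ℕ}
    (hP : ∀ p ∈ P, p.Coprime q) {p : ℕ} (hp : p ∈ P) :
    (fun χ : DirichletCharacter ℂ q ↦ (χ p - 1 / 2) * (resonator P χ : ℂ)) ∈ positiveCone q := by
  have hu := (ZMod.isUnit_iff_coprime p q).2 (hP p hp)
  have h := mul_mem (mul_mem (positiveCone.eval_mem (p : ZMod q))
    (positiveCone.inv_one_sub_mem (r := 1 / 2) (by norm_num) (by norm_num) hu))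
    (resonator_mem_positiveCone (P := P.erase p) fun l hl ↦ hP l (Finset.mem_of_mem_erase hl))
  convert! h using 1
  ext χ
  have hz : ‖χ p‖ = 1 := by
    obtain ⟨u, hu⟩ := hu
    rw [← hu]
    exact χ.unit_norm_eq_one u
  have hne : 1 - χ p / 2 ≠ 0 := by
    intro h0
    have := (norm_one_sub_half_bounds hz.le).1
    rw [h0, norm_zero] at this
    norm_num at this
  have hzz : χ p * (starRingEnd ℂ) (χ p) = 1 := by
    rw [Complex.mul_conj, Complex.normSq_eq_norm_sq, hz]
    norm_num
  have hK : (((‖1 - χ p / 2‖ ^ 2)⁻¹ : ℝ) : ℂ) =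
      ((1 - χ p / 2) * (starRingEnd ℂ) (1 - χ p / 2))⁻¹ := by
    rw [Complex.mul_conj, Complex.normSq_eq_norm_sq]
    push_cast
    rfl
  have hne' := (map_ne_zero (starRingEnd ℂ)).2 hne
  rw [resonator, ← Finset.mul_prod_erase P _ hp, Complex.ofReal_mul, hK]
  simp only [Pi.mul_apply]
  rw [← mul_assoc]
  congr 1
  have h2 : χ p - 1 / 2 = χ p * (starRingEnd ℂ) (1 - χ p / 2) := by
    simp only [map_sub, map_one, map_div₀, Complex.conj_ofNat]
    linear_combination (1 / 2 : ℂ) * hzz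
  rw [h2]
  push_cast
  have h3 : 1 - 1 / 2 * χ p = 1 - χ p / 2 := by ring
  rw [h3]
  generalize (starRingEnd ℂ) (1 - χ p / 2) = y at *
  generalize 1 - χ p / 2 = x at *
  field_simp

open Finset in
theorem resonance {q : ℕ} [NeZero q] {P : Finset ℕ} (hP : ∀ p ∈ P, p.Coprime q) {w : ℕ → ℝ}
    (hw : ∀ p ∈ P, 0 ≤ w p) {D L A : DirichletCharacter ℂ q → ℂ} (hA : A ∈ positiveCone q)
    (hL : L ∈ positiveCone q) (hLA : L - A ∈ positiveCone q)
    (hDA : D - (fun χ ↦ ∑ p ∈ P, (w p : ℂ) * χ p) * A ∈ positiveCone q) :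
    ∃ t : ℝ, ∑ χ, D χ * star (L χ) * (resonator P χ : ℂ) = t ∧
      1 / 2 * (∑ p ∈ P, w p) * ∑ χ : DirichletCharacter ℂ q, ‖A χ‖ ^ 2 * resonator P χ ≤ t := by
  have hW := resonator_mem_positiveCone hP
  have h1 := mul_mem (mul_mem hDA (positiveCone.star_mem hL)) hW
  have h2 := mul_mem (mul_mem (mul_mem (positiveCone.sum_mem P hw fun p ↦ (p : ZMod q)) hA)
    (positiveCone.star_mem hLA)) hW
  have h3 := mul_mem (mul_mem hA (positiveCone.star_mem hA))
    (sum_mem (S := positiveCone q) (t := P) fun p hp ↦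
      mul_mem (positiveCone.const_mem (hw p hp)) (eval_sub_half_mul_resonator_mem hP hp))
  obtain ⟨t, ht, htsum⟩ := positiveCone.exists_sum_eq (add_mem (add_mem h1 h2) h3)
  refine ⟨t + 1 / 2 * (∑ p ∈ P, w p) *
    ∑ χ : DirichletCharacter ℂ q, ‖A χ‖ ^ 2 * resonator P χ, ?_, by linarith⟩
  rw [Complex.ofReal_add, ← htsum, Complex.ofReal_mul, Complex.ofReal_sum univ,
    mul_sum (univ : Finset (DirichletCharacter ℂ q)), ← sum_add_distrib]
  refine sum_congr rfl fun χ _ ↦ ?_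
  have hnorm : ((‖A χ‖ ^ 2 * resonator P χ : ℝ) : ℂ) = A χ * star (A χ) * (resonator P χ : ℂ) := by
    rw [Complex.star_def, Complex.mul_conj, Complex.normSq_eq_norm_sq]
    push_cast
    rfl
  rw [hnorm]
  simp only [Pi.add_apply, Pi.mul_apply, Pi.sub_apply, Pi.star_apply, Finset.sum_apply]
  have hs : ∑ p ∈ P, (w p : ℂ) * ((χ p - 1 / 2) * (resonator P χ : ℂ)) =
      (∑ p ∈ P, (w p : ℂ) * χ p) * resonator P χ -
        1 / 2 * (∑ p ∈ P, (w p : ℂ)) * resonator P χ := by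
    rw [mul_sum, sum_mul, sum_mul, ← sum_sub_distrib]
    exact sum_congr rfl fun p _ ↦ by ring
  rw [hs]
  push_cast
  simp only [star_sub]
  ring

open Finset in
theorem sum_norm_sq_le {q : ℕ} [NeZero q] (c : ZMod q → ℝ) :
    ∑ χ : DirichletCharacter ℂ q, ‖∑ a, (c a : ℂ) * χ a‖ ^ 2 ≤ q * ∑ a, c a ^ 2 := by
  have h : ((∑ χ : DirichletCharacter ℂ q, ‖∑ a, (c a : ℂ) * χ a‖ ^ 2 : ℝ) : ℂ) =
      ((∑ b, if IsUnit b then (q.totient : ℝ) * c b ^ 2 else 0 : ℝ) : ℂ) := by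
    have h1 (χ : DirichletCharacter ℂ q) : ((‖∑ a, (c a : ℂ) * χ a‖ ^ 2 : ℝ) : ℂ) =
        ∑ b, ∑ a, (c b * c a : ℂ) * (star (χ b) * χ a) := by
      rw [← Complex.normSq_eq_norm_sq, ← Complex.mul_conj, map_sum, mul_comm, sum_mul_sum]
      refine sum_congr rfl fun b _ ↦ sum_congr rfl fun a _ ↦ ?_
      rw [map_mul, Complex.conj_ofReal, Complex.star_def]
      ring
    rw [Complex.ofReal_sum, sum_congr rfl fun χ _ ↦ h1 χ, sum_comm, Complex.ofReal_sum]
    refine sum_congr rfl fun b _ ↦ ?_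
    rw [sum_comm]
    simp_rw [← mul_sum]
    split_ifs with hb
    · have h2 (χ : DirichletCharacter ℂ q) : star (χ b) = χ b⁻¹ := by
        obtain ⟨u, rfl⟩ := hb
        rw [MulChar.star_apply', MulChar.inv_apply, Ring.inverse_unit, ZMod.inv_coe_unit]
      simp_rw [h2, DirichletCharacter.sum_char_inv_mul_char_eq ℂ hb]
      simp
      ring
    · simp [fun χ : DirichletCharacter ℂ q ↦ MulChar.map_nonunit χ hb]
  rw [Complex.ofReal_inj] at h
  rw [h, mul_sum]
  refine sum_le_sum fun b _ ↦ ?_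
  split_ifs
  · gcongr
    exact Nat.totient_le q
  · positivity

theorem le_sum_norm_sq {q : ℕ} [NeZero q] {A : DirichletCharacter ℂ q → ℂ}
    (hA : A - 1 ∈ positiveCone q) :
    (q.totient : ℝ) ≤ ∑ χ : DirichletCharacter ℂ q, ‖A χ‖ ^ 2 := by
  have hs := positiveCone.star_mem hA
  obtain ⟨t, ht, hsum⟩ := positiveCone.exists_sum_eq (add_mem (add_mem (mul_mem hA hs) hA) hs)
  have h1 : ((∑ χ : DirichletCharacter ℂ q, ‖A χ‖ ^ 2 : ℝ) : ℂ) = t + q.totient := by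
    have hc : ∑ χ : DirichletCharacter ℂ q, (1 : ℂ) = q.totient := by
      simpa using DirichletCharacter.sum_characters_eq ℂ (n := q) 1
    rw [← hsum, ← hc, ← Finset.sum_add_distrib, Complex.ofReal_sum]
    refine Finset.sum_congr rfl fun χ _ ↦ ?_
    rw [← Complex.normSq_eq_norm_sq, ← Complex.mul_conj]
    simp
    ring
  have h2 : (∑ χ : DirichletCharacter ℂ q, ‖A χ‖ ^ 2 : ℝ) = t + q.totient := by exact_mod_cast h1
  linarith

open Finset in
theorem sum_log_le_log_of_mul_eq {P : Finset ℕ} (hP : ∀ p ∈ P, p.Prime) (M : ℕ) {a : ℕ}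
    (ha : a ≠ 0) :
    ∑ x ∈ P ×ˢ Icc 1 M with x.1 * x.2 = a, Real.log x.1 ≤ Real.log a := by
  have hinj : Set.InjOn Prod.fst
      (((P ×ˢ Icc 1 M).filter fun x ↦ x.1 * x.2 = a : Finset (ℕ × ℕ)) : Set (ℕ × ℕ)) := by
    rintro ⟨p, l⟩ hx ⟨p', l'⟩ hx' (rfl : p = p')
    simp only [coe_filter, mem_product, Set.mem_ofPred_eq] at hx hx'
    have := Nat.eq_of_mul_eq_mul_left (hP p hx.1.1).pos (hx.2.trans hx'.2.symm)
    rw [this]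
  calc ∑ x ∈ P ×ˢ Icc 1 M with x.1 * x.2 = a, Real.log x.1
      = ∑ x ∈ P ×ˢ Icc 1 M with x.1 * x.2 = a, ArithmeticFunction.vonMangoldt x.1 := by
        refine sum_congr rfl fun x hx ↦ ?_
        simp only [mem_filter, mem_product] at hx
        rw [ArithmeticFunction.vonMangoldt_apply_prime (hP _ hx.1.1)]
    _ = ∑ p ∈ image Prod.fst ((P ×ˢ Icc 1 M).filter fun x ↦ x.1 * x.2 = a),
          ArithmeticFunction.vonMangoldt p := (sum_image hinj).symm
    _ ≤ ∑ p ∈ a.divisors, ArithmeticFunction.vonMangoldt p := by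
        refine sum_le_sum_of_subset_of_nonneg (fun p hp ↦ ?_) fun p _ _ ↦
          ArithmeticFunction.vonMangoldt_nonneg
        simp only [mem_image, mem_filter] at hp
        obtain ⟨x, hx, rfl⟩ := hp
        exact Nat.mem_divisors.2 ⟨⟨_, hx.2.symm⟩, ha⟩
    _ = Real.log a := ArithmeticFunction.vonMangoldt_sum

/-- The truncation at `M` of the Dirichlet series of `χ` at the point `σ`. -/
noncomputable def partialLSum {q : ℕ} (σ : ℝ) (M : ℕ) (χ : DirichletCharacter ℂ q) : ℂ :=
  ∑ l ∈ Finset.Icc 1 M, ((l : ℝ) ^ (-σ) : ℝ) * χ l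

theorem partialLSum_mem_positiveCone {q : ℕ} (σ : ℝ) (M : ℕ) :
    partialLSum σ M ∈ positiveCone q :=
  positiveCone.sum_mem (Finset.Icc 1 M) (c := fun l ↦ (l : ℝ) ^ (-σ)) (fun _ _ ↦ by positivity)
    fun l ↦ (l : ZMod q)

theorem partialLSum_sub_one_mem_positiveCone {q : ℕ} (σ : ℝ) {M : ℕ} (hM : 1 ≤ M) :
    partialLSum σ M - 1 ∈ positiveCone q := by
  convert! positiveCone.sum_mem (q := q) ((Finset.Icc 1 M).erase 1) (c := fun l ↦ (l : ℝ) ^ (-σ))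
    (fun _ _ ↦ by positivity) (fun l ↦ (l : ZMod q)) using 1
  ext χ
  rw [Pi.sub_apply, partialLSum, ← Finset.add_sum_erase _ _ (Finset.mem_Icc.2 ⟨le_rfl, hM⟩)]
  simp

open Finset in
theorem sub_mul_partialLSum_mem_positiveCone {q : ℕ} {σ : ℝ} {P : Finset ℕ}
    (hP : ∀ p ∈ P, p.Prime) {M : ℕ} (hPM : ∀ p ∈ P, p * M < q) {e : ℕ → ℝ}
    (he : ∀ a < q, 0 ≤ e a) :
    (fun χ : DirichletCharacter ℂ q ↦
        ∑ a ∈ range q, (Real.log a * (a : ℝ) ^ (-σ) + e a : ℝ) * χ a) -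
      (fun χ : DirichletCharacter ℂ q ↦ ∑ p ∈ P, (Real.log p * (p : ℝ) ^ (-σ) : ℝ) * χ p) * partialLSum σ M ∈
        positiveCone q := by
  have h := positiveCone.sum_mem (q := q) (range q) (c := fun a ↦ Real.log a * (a : ℝ) ^ (-σ) + e a -
    ∑ x ∈ P ×ˢ Icc 1 M with x.1 * x.2 = a,
      Real.log x.1 * (x.1 : ℝ) ^ (-σ) * (x.2 : ℝ) ^ (-σ)) ?_ fun a ↦ (a : ZMod q)
  · convert! h using 1
    ext χ
    rw [Pi.sub_apply, Pi.mul_apply, partialLSum, sum_mul_sum, ← sum_product',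
      ← sum_fiberwise_of_maps_to (t := range q) (g := fun x : ℕ × ℕ ↦ x.1 * x.2),
      ← sum_sub_distrib]
    · refine sum_congr rfl fun a _ ↦ ?_
      rw [Complex.ofReal_sub, sub_mul, Complex.ofReal_sum, sum_mul]
      congr 1
      refine sum_congr rfl fun x hx ↦ ?_
      rw [← (mem_filter.1 hx).2]
      push_cast
      rw [map_mul]
      ring
    · rintro ⟨p, l⟩ hx
      obtain ⟨hp, hl⟩ := mem_product.1 hx
      exact mem_range.2 ((Nat.mul_le_mul_left p (mem_Icc.1 hl).2).trans_lt (hPM p hp))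
  · intro a ha
    have hea := he a (mem_range.1 ha)
    have hs : ∑ x ∈ P ×ˢ Icc 1 M with x.1 * x.2 = a,
        Real.log x.1 * (x.1 : ℝ) ^ (-σ) * (x.2 : ℝ) ^ (-σ) =
        (∑ x ∈ P ×ˢ Icc 1 M with x.1 * x.2 = a, Real.log x.1) * (a : ℝ) ^ (-σ) := by
      rw [sum_mul]
      refine sum_congr rfl fun x hx ↦ ?_
      rw [mul_assoc, ← Real.mul_rpow (by positivity) (by positivity), ← (mem_filter.1 hx).2]
      push_cast
      rfl
    rw [hs]
    rcases eq_or_ne a 0 with rfl | ha0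
    · rw [sum_eq_zero]
      · simpa using hea
      · rintro ⟨p, l⟩ hx
        simp only [mem_filter, mem_product, mem_Icc, mul_eq_zero] at hx
        have := (hP p hx.1.1).pos
        lia
    · have := mul_le_mul_of_nonneg_right (sum_log_le_log_of_mul_eq hP M ha0)
        (by positivity : (0 : ℝ) ≤ (a : ℝ) ^ (-σ))
      linarith

open Finset in
theorem sum_sub_partialLSum {q : ℕ} {σ : ℝ} {M : ℕ} (hM : M < q) (e : ℕ → ℝ)
    (χ : DirichletCharacter ℂ q) :
    ∑ a ∈ range q, ((a : ℝ) ^ (-σ) + e a : ℝ) * χ a - partialLSum σ M χ =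
      ∑ a ∈ range q, ((if a ∈ Icc 1 M then 0 else (a : ℝ) ^ (-σ)) + e a : ℝ) * χ a := by
  have hsub : Icc 1 M ⊆ range q := fun a ha ↦ mem_range.2 ((mem_Icc.1 ha).2.trans_lt hM)
  have hA : partialLSum σ M χ =
      ∑ a ∈ range q, if a ∈ Icc 1 M then (((a : ℝ) ^ (-σ) : ℝ) : ℂ) * χ a else 0 := by
    rw [sum_ite_mem, inter_eq_right.2 hsub, partialLSum]
  rw [hA, ← sum_sub_distrib]
  refine sum_congr rfl fun a _ ↦ ?_
  split_ifs
  · push_cast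
    ring
  · simp

open Finset in
theorem sum_range_rpow_neg_le {σ : ℝ} (hσ : σ ∈ Set.Ioo (0 : ℝ) 1) (n : ℕ) :
    ∑ a ∈ range (n + 1), (a : ℝ) ^ (-σ) ≤ (1 - σ)⁻¹ * (n : ℝ) ^ (1 - σ) := by
  have h1 : 0 < 1 - σ := by linarith [hσ.2]
  induction n with
  | zero => simp [Real.zero_rpow (neg_ne_zero.2 hσ.1.ne'), Real.zero_rpow h1.ne']
  | succ n ih =>
    rw [sum_range_succ]
    refine (add_le_add_left ih _).trans ?_
    set x : ℝ := ((n + 1 : ℕ) : ℝ) with hx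
    have hx1 : 1 ≤ x := by simp [hx]
    have hx0 : 0 < x := by linarith
    have hb := rpow_one_add_le_one_add_mul_self (s := -x⁻¹) (p := 1 - σ)
      (neg_le_neg (inv_le_one_of_one_le₀ hx1)) h1.le (by linarith [hσ.1])
    have hn : (n : ℝ) = x * (1 + -x⁻¹) := by
      rw [mul_add, mul_neg, mul_inv_cancel₀ hx0.ne', hx]
      push_cast
      ring
    have h0 : 0 ≤ 1 + -x⁻¹ := by
      have := inv_le_one_of_one_le₀ hx1
      linarith
    have hxs : x ^ (1 - σ) * x⁻¹ = x ^ (-σ) := by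
      rw [← Real.rpow_neg_one x, ← Real.rpow_add hx0]
      ring_nf
    rw [hn, Real.mul_rpow hx0.le h0]
    have hm := mul_le_mul_of_nonneg_left hb (by positivity : 0 ≤ (1 - σ)⁻¹ * x ^ (1 - σ))
    have hi : (1 - σ)⁻¹ * (1 - σ) = 1 := inv_mul_cancel₀ h1.ne'
    calc _ ≤ (1 - σ)⁻¹ * x ^ (1 - σ) * (1 + (1 - σ) * -x⁻¹) + x ^ (-σ) := by linarith
      _ = (1 - σ)⁻¹ * x ^ (1 - σ) - ((1 - σ)⁻¹ * (1 - σ)) * (x ^ (1 - σ) * x⁻¹) + x ^ (-σ) := by ring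
      _ = _ := by rw [hi, hxs]; ring

open Finset in
theorem sum_norm_sq_range_le {q : ℕ} [NeZero q] (c : ℕ → ℝ) :
    ∑ χ : DirichletCharacter ℂ q, ‖∑ a ∈ range q, (c a : ℂ) * χ a‖ ^ 2 ≤
      q * ∑ a ∈ range q, c a ^ 2 := by
  have h := sum_norm_sq_le (q := q) fun a ↦ c a.val
  rw [sum_zmod_eq_sum_range] at h
  simp_rw [sum_zmod_eq_sum_range] at h
  have h1 : ∑ a ∈ range q, c (a : ZMod q).val ^ 2 = ∑ a ∈ range q, c a ^ 2 :=
    sum_congr rfl fun a ha ↦ by rw [ZMod.val_cast_of_lt (mem_range.1 ha)]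
  have h2 (χ : DirichletCharacter ℂ q) : ∑ a ∈ range q, (c (a : ZMod q).val : ℂ) * χ a =
      ∑ a ∈ range q, (c a : ℂ) * χ a :=
    sum_congr rfl fun a ha ↦ by rw [ZMod.val_cast_of_lt (mem_range.1 ha)]
  simpa only [h1, h2] using h

theorem norm_sq_le_two_mul {E : Type*} [SeminormedAddCommGroup E] (x y : E) :
    ‖x‖ ^ 2 ≤ 2 * ‖y‖ ^ 2 + 2 * ‖x - y‖ ^ 2 := by
  have h := norm_add_le y (x - y)
  rw [add_sub_cancel] at h
  nlinarith [norm_nonneg x, sq_nonneg (‖y‖ - ‖x - y‖)]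

open Finset in
theorem re_mul_sum_le {q : ℕ} [NeZero q] {P : Finset ℕ} {D L A : DirichletCharacter ℂ q → ℂ}
    {u : ℂ} (hu : ‖u‖ ≤ 1) {V t : ℝ} (hV : 0 ≤ V)
    (ht : ∑ χ, D χ * star (L χ) * (resonator P χ : ℂ) = t)
    (H : ∀ χ ≠ 1, (u * (D χ * star (L χ))).re ≤ V * ‖L χ‖ ^ 2) :
    u.re * t ≤ 2 * V * ∑ χ : DirichletCharacter ℂ q, ‖A χ‖ ^ 2 * resonator P χ +
      4 ^ P.card * (2 * V * ∑ χ : DirichletCharacter ℂ q, ‖L χ - A χ‖ ^ 2 + ‖D 1‖ * ‖L 1‖) := by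
  classical
  have hterm (χ : DirichletCharacter ℂ q) (hχ : χ ≠ 1) :
      (u * (D χ * star (L χ))).re * resonator P χ ≤
        2 * V * (‖A χ‖ ^ 2 * resonator P χ) + 4 ^ P.card * (2 * V * ‖L χ - A χ‖ ^ 2) := by
    have h0 := resonator_nonneg P χ
    calc _ ≤ V * (2 * ‖A χ‖ ^ 2 + 2 * ‖L χ - A χ‖ ^ 2) * resonator P χ := by
          gcongr
          exact (H χ hχ).trans (mul_le_mul_of_nonneg_left (norm_sq_le_two_mul _ _) hV)
      _ = 2 * V * (‖A χ‖ ^ 2 * resonator P χ) + resonator P χ * (2 * V * ‖L χ - A χ‖ ^ 2) := by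
          ring
      _ ≤ _ := by
          gcongr
          exact resonator_le P χ
  have hone : (u * (D 1 * star (L 1))).re * resonator P (1 : DirichletCharacter ℂ q) ≤ 4 ^ P.card * (‖D 1‖ * ‖L 1‖) := by
    calc _ ≤ (‖D 1‖ * ‖L 1‖) * resonator P (1 : DirichletCharacter ℂ q) := by
          refine mul_le_mul_of_nonneg_right ((Complex.re_le_norm _).trans ?_) (resonator_nonneg P _)
          rw [norm_mul, norm_mul, norm_star]
          exact mul_le_of_le_one_left (by positivity) hu
      _ ≤ (‖D 1‖ * ‖L 1‖) * 4 ^ P.card := by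
          gcongr
          exact resonator_le P _
      _ = _ := mul_comm _ _
  have hsum : u.re * t = ∑ χ, (u * (D χ * star (L χ))).re * resonator P χ := by
    rw [← Complex.re_mul_ofReal, ← ht, mul_sum, Complex.re_sum]
    refine sum_congr rfl fun χ _ ↦ ?_
    rw [← mul_assoc, Complex.re_mul_ofReal]
  rw [hsum, ← add_sum_erase _ _ (mem_univ (1 : DirichletCharacter ℂ q))]
  have hrest := sum_le_sum fun χ (hχ : χ ∈ univ.erase (1 : DirichletCharacter ℂ q)) ↦
    hterm χ (ne_of_mem_erase hχ)
  have hext := sum_le_sum_of_subset_of_nonneg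
    (f := fun χ : DirichletCharacter ℂ q ↦
      2 * V * (‖A χ‖ ^ 2 * resonator P χ) + 4 ^ P.card * (2 * V * ‖L χ - A χ‖ ^ 2))
    (erase_subset 1 univ) fun χ _ _ ↦ by
      have := resonator_nonneg P χ
      positivity
  rw [sum_add_distrib (s := univ), ← mul_sum, ← mul_sum, ← mul_sum] at hext
  linarith

open Finset in
theorem sum_coefficients_le {σ : ℝ} (hσ : σ ∈ Set.Ioo (0 : ℝ) 1) {q : ℕ} (hq : 0 < q) :
    ∑ a ∈ range q, ((a : ℝ) ^ (-σ) + (q : ℝ) ^ (-σ)) ≤ ((1 - σ)⁻¹ + 1) * (q : ℝ) ^ (1 - σ) := by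
  have hq0 : (0 : ℝ) < q := by exact_mod_cast hq
  rw [sum_add_distrib, sum_const, card_range, nsmul_eq_mul]
  have h1 := sum_range_rpow_neg_le hσ q
  rw [sum_range_succ] at h1
  have h2 : (q : ℝ) * (q : ℝ) ^ (-σ) = (q : ℝ) ^ (1 - σ) := by
    rw [sub_eq_add_neg, Real.rpow_add hq0, Real.rpow_one]
  have h3 : 0 ≤ (q : ℝ) ^ (-σ) := by positivity
  rw [h2]
  linarith

open Finset in
theorem resonance_inequality {σ : ℝ} (hσ : σ ∈ Set.Ioo (0 : ℝ) 1) {q : ℕ} [NeZero q]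
    (hq : q.Prime) (hqσ : Real.exp σ⁻¹ ≤ q) {P : Finset ℕ} (hP : ∀ p ∈ P, p.Prime) {M : ℕ}
    (hM : 1 ≤ M) (hMq : M < q) (hPM : ∀ p ∈ P, p * M < q) {u : ℂ} (hu : ‖u‖ ≤ 1)
    (hu0 : 0 ≤ u.re) {V : ℝ} (hV : 0 ≤ V)
    (H : ∀ χ : DirichletCharacter ℂ q, χ ≠ 1 → χ.LFunction σ ≠ 0 →
      -(u * (deriv χ.LFunction σ / χ.LFunction σ)).re ≤ V) :
    u.re * (1 / 2 * ∑ p ∈ P, Real.log p * (p : ℝ) ^ (-σ)) ≤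
      2 * V + 16 ^ P.card / (q - 1) * (8 * V * (q : ℝ) ^ 2 * (M : ℝ) ^ (-(2 * σ)) +
        ((1 - σ)⁻¹ + 1) ^ 2 * Real.log q * (q : ℝ) ^ (2 - 2 * σ)) := by
  obtain ⟨e, e', he, he', hL⟩ := exists_nonneg_coefficients hσ hq.one_lt hqσ
  have hq1 : (1 : ℝ) < q := by exact_mod_cast hq.one_lt
  have hq0 : (0 : ℝ) < q := by linarith
  have hlog : 0 ≤ Real.log q := Real.log_nonneg hq1.le
  have hM0 : (0 : ℝ) < M := by exact_mod_cast hM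
  have hqM : (q : ℝ) ^ (-σ) ≤ (M : ℝ) ^ (-σ) :=
    Real.rpow_le_rpow_of_nonpos hM0 (by exact_mod_cast hMq.le) (by linarith [hσ.1])
  set L : DirichletCharacter ℂ q → ℂ :=
    fun χ ↦ ∑ a ∈ range q, ((a : ℝ) ^ (-σ) + e a : ℝ) * χ a with hLdef
  set D : DirichletCharacter ℂ q → ℂ :=
    fun χ ↦ ∑ a ∈ range q, (Real.log a * (a : ℝ) ^ (-σ) + e' a : ℝ) * χ a with hDdef
  set A : DirichletCharacter ℂ q → ℂ := partialLSum σ M with hAdef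
  set T := ∑ χ : DirichletCharacter ℂ q, ‖A χ‖ ^ 2 * resonator P χ with hTdef
  have hcop : ∀ p ∈ P, p.Coprime q := fun p hp ↦ by
    refine (Nat.coprime_primes (hP p hp) hq).2 (ne_of_lt ?_)
    exact (Nat.le_mul_of_pos_right p hM).trans_lt (hPM p hp)
  have hLA : L - A = fun χ : DirichletCharacter ℂ q ↦
      ∑ a ∈ range q, ((if a ∈ Icc 1 M then 0 else (a : ℝ) ^ (-σ)) + e a : ℝ) * χ a :=
    funext fun χ ↦ sum_sub_partialLSum hMq e χ
  have hLAmem : L - A ∈ positiveCone q := by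
    rw [hLA]
    refine positiveCone.sum_mem (range q) (fun a ha ↦ ?_) fun a : ℕ ↦ (a : ZMod q)
    have := (he a (mem_range.1 ha)).1
    positivity
  have hLmem : L ∈ positiveCone q := by
    have := add_mem hLAmem (partialLSum_mem_positiveCone σ M)
    rwa [← hAdef, sub_add_cancel] at this
  obtain ⟨t, ht, htT⟩ := resonance hcop (w := fun p ↦ Real.log p * (p : ℝ) ^ (-σ))
    (fun p _ ↦ by positivity) (partialLSum_mem_positiveCone σ M) hLmem hLAmem
    (sub_mul_partialLSum_mem_positiveCone hP hPM fun a ha ↦ (he' a ha).1)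
  have hH : ∀ χ ≠ 1, (u * (D χ * star (L χ))).re ≤ V * ‖L χ‖ ^ 2 := by
    intro χ hχ
    obtain ⟨hL1, hL2⟩ := hL χ hχ
    rcases eq_or_ne (L χ) 0 with h0 | h0
    · simp [h0]
    have hH' := H χ hχ (by rwa [hL1])
    have hD : D χ = -deriv χ.LFunction σ := by rw [hL2, neg_neg]
    change χ.LFunction σ = L χ at hL1
    have hns : L χ * star (L χ) = ((‖L χ‖ ^ 2 : ℝ) : ℂ) := by
      rw [Complex.star_def, Complex.mul_conj, Complex.normSq_eq_norm_sq]
    have heq : u * (D χ * star (L χ)) =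
        -(u * (deriv χ.LFunction σ / χ.LFunction σ)) * ((‖L χ‖ ^ 2 : ℝ) : ℂ) := by
      rw [← hns, hD, hL1]
      field_simp
    rw [heq, Complex.re_mul_ofReal, Complex.neg_re]
    gcongr
  have hmain := re_mul_sum_le (A := A) hu hV ht hH
  have hdiff : ∑ χ : DirichletCharacter ℂ q, ‖L χ - A χ‖ ^ 2 ≤
      4 * (q : ℝ) ^ 2 * (M : ℝ) ^ (-(2 * σ)) := by
    have h1 := sum_norm_sq_range_le (q := q)
      fun a ↦ (if a ∈ Icc 1 M then 0 else (a : ℝ) ^ (-σ)) + e a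
    have h2 (χ : DirichletCharacter ℂ q) : L χ - A χ = _ := congrFun hLA χ
    simp_rw [h2]
    refine h1.trans ?_
    have h3 : ∀ a ∈ range q, ((if a ∈ Icc 1 M then 0 else (a : ℝ) ^ (-σ)) + e a) ^ 2 ≤
        4 * (M : ℝ) ^ (-(2 * σ)) := by
      intro a ha
      obtain ⟨hea, hea'⟩ := he a (mem_range.1 ha)
      have h4 : (if a ∈ Icc 1 M then 0 else (a : ℝ) ^ (-σ)) ≤ (M : ℝ) ^ (-σ) := by
        split_ifs with h
        · positivity
        rcases Nat.eq_zero_or_pos a with rfl | ha0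
        · rw [Nat.cast_zero, Real.zero_rpow (neg_ne_zero.2 hσ.1.ne')]
          positivity
        · have : M ≤ a := by
            rw [mem_Icc] at h
            lia
          exact Real.rpow_le_rpow_of_nonpos hM0 (by exact_mod_cast this) (by linarith [hσ.1])
      have h5 : 0 ≤ (if a ∈ Icc 1 M then 0 else (a : ℝ) ^ (-σ)) := by positivity
      have h6 : (M : ℝ) ^ (-(2 * σ)) = ((M : ℝ) ^ (-σ)) ^ 2 := by
        rw [← Real.rpow_natCast, ← Real.rpow_mul hM0.le]
        congr 1
        push_cast
        ring
      rw [h6]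
      calc _ ≤ (2 * (M : ℝ) ^ (-σ)) ^ 2 := by
            gcongr
            linarith
        _ = _ := by ring
    have h7 := sum_le_card_nsmul _ _ _ h3
    rw [card_range, nsmul_eq_mul] at h7
    calc _ ≤ (q : ℝ) * (q * (4 * (M : ℝ) ^ (-(2 * σ)))) := by gcongr
      _ = _ := by ring
  have hone : ‖D 1‖ * ‖L 1‖ ≤ ((1 - σ)⁻¹ + 1) ^ 2 * Real.log q * (q : ℝ) ^ (2 - 2 * σ) := by
    have hsum := sum_coefficients_le hσ hq.pos
    have hnorm (c : ℕ → ℝ) (hc : ∀ a ∈ range q, 0 ≤ c a) :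
        ‖∑ a ∈ range q, (c a : ℂ) * (1 : DirichletCharacter ℂ q) a‖ ≤ ∑ a ∈ range q, c a := by
      refine norm_sum_le_of_le _ fun a ha ↦ ?_
      rw [norm_mul, Complex.norm_real, Real.norm_of_nonneg (hc a ha)]
      exact mul_le_of_le_one_right (hc a ha) (DirichletCharacter.norm_le_one _ _)
    have hL1 : ‖L 1‖ ≤ ((1 - σ)⁻¹ + 1) * (q : ℝ) ^ (1 - σ) := by
      refine (hnorm (fun a ↦ (a : ℝ) ^ (-σ) + e a) fun a ha ↦ ?_).trans
        ((sum_le_sum fun a ha ↦ ?_).trans hsum)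
      · have := (he a (mem_range.1 ha)).1
        positivity
      · have := (he a (mem_range.1 ha)).2
        linarith
    have hD1 : ‖D 1‖ ≤ Real.log q * (((1 - σ)⁻¹ + 1) * (q : ℝ) ^ (1 - σ)) := by
      refine (hnorm (fun a ↦ Real.log a * (a : ℝ) ^ (-σ) + e' a) fun a ha ↦ ?_).trans ?_
      · have := (he' a (mem_range.1 ha)).1
        positivity
      refine le_trans ?_ (mul_le_mul_of_nonneg_left hsum hlog)
      rw [mul_sum]
      refine sum_le_sum fun a ha ↦ ?_
      have h1 := (he' a (mem_range.1 ha)).2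
      rw [mul_add]
      refine add_le_add ?_ h1
      rcases Nat.eq_zero_or_pos a with rfl | ha0
      · simp [Real.zero_rpow (neg_ne_zero.2 hσ.1.ne')]
      gcongr
      exact (mem_range.1 ha).le
    have hexp : (q : ℝ) ^ (2 - 2 * σ) = (q : ℝ) ^ (1 - σ) * (q : ℝ) ^ (1 - σ) := by
      rw [← Real.rpow_add hq0]
      ring_nf
    rw [hexp]
    calc _ ≤ (Real.log q * (((1 - σ)⁻¹ + 1) * (q : ℝ) ^ (1 - σ))) *
          (((1 - σ)⁻¹ + 1) * (q : ℝ) ^ (1 - σ)) :=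
          mul_le_mul hD1 hL1 (norm_nonneg _) ((norm_nonneg _).trans hD1)
      _ = _ := by ring
  have hT : ((q : ℝ) - 1) / 4 ^ P.card ≤ T := by
    have h1 := le_sum_norm_sq (partialLSum_sub_one_mem_positiveCone (q := q) σ hM)
    rw [Nat.totient_prime hq, Nat.cast_sub hq.one_le, Nat.cast_one] at h1
    calc ((q : ℝ) - 1) / 4 ^ P.card
        ≤ (∑ χ : DirichletCharacter ℂ q, ‖A χ‖ ^ 2) * (4 ^ P.card)⁻¹ := by
          rw [div_eq_mul_inv]
          gcongr
      _ ≤ T := by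
          rw [hTdef, sum_mul]
          gcongr with χ
          exact inv_le_resonator P χ
  have hq1' : (0 : ℝ) < q - 1 := by linarith
  have hTpos : 0 < T := lt_of_lt_of_le (by positivity) hT
  set E := 8 * V * (q : ℝ) ^ 2 * (M : ℝ) ^ (-(2 * σ)) +
        ((1 - σ)⁻¹ + 1) ^ 2 * Real.log q * (q : ℝ) ^ (2 - 2 * σ) with hE
  have hE0 : 0 ≤ E := by positivity
  have hET : 4 ^ P.card * E ≤ 16 ^ P.card / (q - 1) * E * T := by
    have h16 : (16 : ℝ) ^ P.card = 4 ^ P.card * 4 ^ P.card := by rw [← mul_pow]; norm_num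
    calc 4 ^ P.card * E = 16 ^ P.card / (q - 1) * E * ((q - 1) / 4 ^ P.card) := by
          rw [h16]
          field_simp
      _ ≤ _ := by gcongr
  refine le_of_mul_le_mul_right ?_ hTpos
  calc u.re * (1 / 2 * ∑ p ∈ P, Real.log p * (p : ℝ) ^ (-σ)) * T
      = u.re * (1 / 2 * (∑ p ∈ P, Real.log p * (p : ℝ) ^ (-σ)) * T) := by ring
    _ ≤ u.re * t := mul_le_mul_of_nonneg_left htT hu0
    _ ≤ 2 * V * T + 4 ^ P.card * (2 * V * (4 * (q : ℝ) ^ 2 * (M : ℝ) ^ (-(2 * σ))) +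
          ((1 - σ)⁻¹ + 1) ^ 2 * Real.log q * (q : ℝ) ^ (2 - 2 * σ)) := by
        refine hmain.trans ?_
        gcongr
    _ = 2 * V * T + 4 ^ P.card * E := by rw [hE]; ring
    _ ≤ 2 * V * T + 16 ^ P.card / (q - 1) * E * T := by linarith
    _ = _ := by ring

open Filter Topology in
theorem eventually_half_le_theta : ∀ᶠ x : ℝ in atTop, x / 2 ≤ Chebyshev.theta x := by
  have h1 := Real.isLittleO_log_id_atTop.bound (show (0 : ℝ) < 1 / 100 by norm_num)
  have h2 := (isLittleO_log_rpow_atTop (show (0 : ℝ) < 1 / 2 by norm_num)).bound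
    (show (0 : ℝ) < 1 / 50 by norm_num)
  filter_upwards [h1, h2, eventually_ge_atTop 100] with x h1 h2 hx
  have hlog : 0 ≤ Real.log x := Real.log_nonneg (by linarith)
  rw [id, Real.norm_of_nonneg hlog, Real.norm_of_nonneg (by linarith)] at h1
  rw [Real.norm_of_nonneg hlog, ← Real.sqrt_eq_rpow, Real.norm_of_nonneg (Real.sqrt_nonneg x)] at h2
  have h3 := Chebyshev.theta_ge' (x := x) (by linarith)
  have h4 : Real.log (x + 2) ≤ Real.log x + 1 := by
    rw [← Real.log_exp 1, ← Real.log_mul (by linarith) (Real.exp_pos 1).ne']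
    refine Real.log_le_log (by linarith) ?_
    nlinarith [Real.exp_one_gt_d9]
  have h5 : √x * Real.log x ≤ 1 / 50 * x := by
    calc √x * Real.log x ≤ √x * (1 / 50 * √x) := by gcongr
      _ = 1 / 50 * (√x * √x) := by ring
      _ = _ := by rw [Real.mul_self_sqrt (by linarith)]
  nlinarith [Real.log_two_gt_d9, Real.log_two_lt_d9]

open Filter in
theorem eventually_primeCounting_le_two_mul_div :
    ∀ᶠ x : ℝ in atTop, (Nat.primeCounting ⌊x⌋₊ : ℝ) ≤ 2 * x / Real.log x := by
  have hlog4 : Real.log 4 = 2 * Real.log 2 := by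
    rw [show (4 : ℝ) = 2 ^ 2 by norm_num, Real.log_pow]
    norm_num
  filter_upwards [Chebyshev.eventually_primeCounting_le (show (0 : ℝ) < 1 / 2 by norm_num),
    eventually_ge_atTop 1] with x hx hx1
  have hlog := Real.log_nonneg hx1
  refine hx.trans ?_
  gcongr
  linarith [Real.log_two_lt_d9]

theorem rpow_neg_mul_theta_le {σ x : ℝ} (hσ : 0 ≤ σ) (hx : 0 ≤ x) :
    x ^ (-σ) * Chebyshev.theta x ≤
      ∑ p ∈ Nat.primesLE ⌊x⌋₊, Real.log p * (p : ℝ) ^ (-σ) := by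
  rw [Chebyshev.theta_eq_sum_primesLE, Finset.mul_sum]
  refine Finset.sum_le_sum fun p hp ↦ ?_
  obtain ⟨hpx, hp⟩ := Nat.mem_primesLE.1 hp
  have hp0 : (0 : ℝ) < p := by exact_mod_cast hp.pos
  rw [mul_comm]
  gcongr ?_ * ?_
  exact Real.rpow_le_rpow_of_nonpos hp0 ((Nat.le_floor_iff hx).1 hpx) (by linarith)

theorem sixteen_pow_primeCounting_le {δ l y : ℝ} (hl : 1 < l) (hly : l ≤ y)
    (hy : y = δ * l * Real.log l)
    (hπ : (Nat.primeCounting ⌊y⌋₊ : ℝ) ≤ 2 * y / Real.log y) :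
    (16 : ℝ) ^ (Nat.primesLE ⌊y⌋₊).card ≤ Real.exp (6 * δ * l) := by
  have hlog : 0 < Real.log l := Real.log_pos hl
  have hlogy : Real.log l ≤ Real.log y := Real.log_le_log (by linarith) hly
  have h16 : Real.log 16 ≤ 3 := by
    rw [show (16 : ℝ) = 2 ^ 4 by norm_num, Real.log_pow]
    norm_num
    linarith [Real.log_two_lt_d9]
  have hcard : (Nat.primeCounting ⌊y⌋₊ : ℝ) ≤ 2 * (δ * l) := by
    refine hπ.trans ?_
    calc 2 * y / Real.log y ≤ 2 * y / Real.log l := by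
          have : 0 ≤ y := by linarith
          gcongr
      _ = 2 * (δ * l) := by
          rw [hy]
          field_simp
  rw [Nat.primesLE_card_eq_primeCounting, ← Real.rpow_natCast,
    Real.rpow_def_of_pos (by norm_num)]
  refine Real.exp_le_exp.2 ?_
  nlinarith [Nat.cast_nonneg (α := ℝ) (Nat.primeCounting ⌊y⌋₊)]

/-- The contribution of the principal character and of the tail of the Dirichlet series is a
negative power of the modulus, up to logarithms. -/
theorem resonance_error_le {σ : ℝ} (hσ : σ ∈ Set.Ioo (0 : ℝ) 1) {x y l m a b C V : ℝ}
    (hx : x = Real.exp l) (hl : 1 ≤ l) (hy1 : 1 ≤ y) (hy : y ≤ l ^ 2) (hm : x / (2 * y) ≤ m)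
    (hV0 : 0 ≤ V) (hV : V ≤ b * l ^ 2) (hC : 0 ≤ C) {N : ℝ} (hN : N ≤ Real.exp (a * l)) :
    N / (x - 1) * (8 * V * x ^ 2 * m ^ (-(2 * σ)) + C * l * x ^ (2 - 2 * σ)) ≤
      (64 * b + 2 * C) * (l ^ 6 * Real.exp (-(2 * σ - 1 - a) * l)) := by
  have hx2 : 2 ≤ x := by linarith [Real.add_one_le_exp l]
  have hx0 : 0 < x := by linarith
  have hb : 0 ≤ b := by
    by_contra! hb
    nlinarith [pow_pos (show 0 < l by linarith) 2]
  have hm' : m ^ (-(2 * σ)) ≤ x ^ (-(2 * σ)) * (4 * l ^ 4) := by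
    calc m ^ (-(2 * σ)) ≤ (x / (2 * y)) ^ (-(2 * σ)) :=
          Real.rpow_le_rpow_of_nonpos (by positivity) hm (by linarith [hσ.1])
      _ = x ^ (-(2 * σ)) * (2 * y) ^ (2 * σ) := by
          rw [Real.div_rpow hx0.le (by positivity), Real.rpow_neg (by positivity : 0 ≤ 2 * y),
            div_inv_eq_mul]
      _ ≤ x ^ (-(2 * σ)) * (2 * y) ^ (2 : ℝ) := by
          gcongr
          · linarith
          · linarith [hσ.2]
      _ ≤ x ^ (-(2 * σ)) * (2 * l ^ 2) ^ (2 : ℝ) := by gcongr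
      _ = _ := by
          rw [Real.rpow_two]
          ring
  have hx1 : N / (x - 1) ≤ Real.exp (a * l) * (2 / x) := by
    calc N / (x - 1) ≤ Real.exp (a * l) / (x - 1) := by
          gcongr
          linarith
      _ ≤ Real.exp (a * l) / (x / 2) := by
          gcongr
          linarith
      _ = _ := by
          field_simp
  have hxσ : x ^ (2 - 2 * σ) = x ^ 2 * x ^ (-(2 * σ)) := by
    rw [sub_eq_add_neg, Real.rpow_add hx0, Real.rpow_two]
  have hl6 : l ≤ l ^ 6 := le_self_pow₀ hl (by norm_num)
  have hexp : Real.exp (a * l) * (2 / x) * (x ^ 2 * x ^ (-(2 * σ))) =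
      2 * Real.exp (-(2 * σ - 1 - a) * l) := by
    have : x ^ 2 * x ^ (-(2 * σ)) = Real.exp (2 * l + l * -(2 * σ)) := by
      rw [hx, ← Real.exp_nat_mul, ← Real.exp_mul, ← Real.exp_add]
      norm_num
    rw [this, hx, div_eq_mul_inv, ← Real.exp_neg,
      show ∀ u v w : ℝ, u * (2 * v) * w = 2 * (u * v * w) by intros; ring,
      ← Real.exp_add, ← Real.exp_add]
    congr 2
    ring
  calc _ ≤ Real.exp (a * l) * (2 / x) * (8 * (b * l ^ 2) * x ^ 2 *
        (x ^ (-(2 * σ)) * (4 * l ^ 4)) + C * l ^ 6 * (x ^ 2 * x ^ (-(2 * σ)))) := by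
        rw [hxσ]
        have : 0 ≤ m := le_trans (by positivity) hm
        gcongr
    _ = Real.exp (a * l) * (2 / x) * (x ^ 2 * x ^ (-(2 * σ))) * ((32 * b + C) * l ^ 6) := by ring
    _ = _ := by
        rw [hexp]
        ring

theorem cos_pos_of_mem {θ : ℝ}
    (hθ : θ ∈ Set.Ico 0 (Real.pi / 2) ∪ Set.Ioc (3 * Real.pi / 2) (2 * Real.pi)) :
    0 < Real.cos θ := by
  rcases hθ with h | h
  · exact Real.cos_pos_of_mem_Ioo ⟨by linarith [h.1, Real.pi_pos], h.2⟩
  · rw [← Real.cos_sub_two_pi]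
    exact Real.cos_pos_of_mem_Ioo ⟨by linarith [h.1], by linarith [h.2, Real.pi_pos]⟩

open Filter Topology in
theorem tendsto_const_mul_pow_mul_exp_neg (C : ℝ) (n : ℕ) {a : ℝ} (ha : 0 < a) :
    Tendsto (fun l : ℝ ↦ C * (l ^ n * Real.exp (-a * l))) atTop (𝓝 0) := by
  have h := (isLittleO_pow_exp_pos_mul_atTop (k := n) ha).tendsto_div_nhds_zero.const_mul C
  rw [mul_zero] at h
  refine h.congr fun l ↦ ?_
  rw [neg_mul, Real.exp_neg, div_eq_mul_inv]

open Filter in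
/-- For fixed `σ ∈ (1/2, 1)` and `θ ∈ [0, π/2) ∪ (3π/2, 2π]`, there is a
constant `c > 0` (depending only on `σ` and `θ`) such that for all sufficiently large primes
`q` there is a non-principal Dirichlet character `χ` mod `q` with `L(σ, χ) ≠ 0` and
`-Re(e^{-iθ} L'(σ,χ)/L(σ,χ)) ≥ c (log q)^{1-σ} (log log q)^{1-σ}`. -/
theorem large_values_of_twisted_log_derivative (σ θ : ℝ) (hσ : σ ∈ Set.Ioo (1/2 : ℝ) 1)
    (hθ : θ ∈ Set.Ico 0 (Real.pi / 2) ∪ Set.Ioc (3 * Real.pi / 2) (2 * Real.pi)) :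
    ∃ c : ℝ, 0 < c ∧ ∃ Q : ℕ, ∀ (q : ℕ) [NeZero q], q.Prime → Q ≤ q →
      ∃ χ : DirichletCharacter ℂ q, χ ≠ 1 ∧
        DirichletCharacter.LFunction χ (σ : ℂ) ≠ 0 ∧
        c * (Real.log q) ^ (1 - σ) * (Real.log (Real.log q)) ^ (1 - σ) ≤
          -(Complex.exp (-(θ : ℂ) * Complex.I) *
              (deriv (DirichletCharacter.LFunction χ) (σ : ℂ) /
                DirichletCharacter.LFunction χ (σ : ℂ))).re := by
  have hcos : 0 < Real.cos θ := cos_pos_of_mem hθ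
  have hσ' : σ ∈ Set.Ioo (0 : ℝ) 1 := ⟨by linarith [hσ.1], hσ.2⟩
  set ε := 2 * σ - 1 with hε
  have hε0 : 0 < ε := by linarith [hσ.1]
  set δ := ε / 12 with hδ
  have hδ0 : 0 < δ := by positivity
  have hδ1 : δ ≤ 1 := by linarith [hσ.2]
  set c := Real.cos θ * δ ^ (1 - σ) / 16 with hc
  have hc0 : 0 < c := by positivity
  set C := ((1 - σ)⁻¹ + 1) ^ 2 with hC
  have hlog : Tendsto (fun q : ℕ ↦ Real.log q) atTop atTop :=
    Real.tendsto_log_atTop.comp tendsto_natCast_atTop_atTop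
  have hy : Tendsto (fun l : ℝ ↦ δ * l * Real.log l) atTop atTop :=
    (tendsto_id.const_mul_atTop hδ0).atTop_mul_atTop₀ Real.tendsto_log_atTop
  have hE := tendsto_const_mul_pow_mul_exp_neg (64 * c + 2 * C) 6 (half_pos hε0)
  have hexp := (Real.tendsto_exp_div_pow_atTop 2).eventually_ge_atTop 4
  obtain ⟨Q, hQ⟩ := eventually_atTop.1 <| (hlog.eventually (hE.eventually_le_const hc0)).and <|
    (hlog.eventually hexp).and <| (hlog.eventually (hy.eventually eventually_half_le_theta)).and <|
    (hlog.eventually (hy.eventually eventually_primeCounting_le_two_mul_div)).and <|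
    (hlog.eventually_ge_atTop 3).and <| (hlog.eventually_ge_atTop σ⁻¹).and <|
    hlog.eventually (Real.tendsto_log_atTop.eventually_ge_atTop δ⁻¹)
  refine ⟨c, hc0, Q, fun q _ hq hQq ↦ ?_⟩
  obtain ⟨hE, hexp, hθy, hπy, hl3, hlσ, hlδ⟩ := hQ q hQq
  by_contra! hcon
  have hq0 : (0 : ℝ) < q := by exact_mod_cast hq.pos
  set l := Real.log q with hl
  set y := δ * l * Real.log l with hydef
  have hql : (q : ℝ) = Real.exp l := (Real.exp_log hq0).symm
  have hl0 : 0 < l := by linarith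
  have hlogl : 1 ≤ Real.log l := le_trans ((one_le_inv₀ hδ0).2 hδ1) hlδ
  have hlogl' : Real.log l ≤ l := by linarith [Real.log_le_sub_one_of_pos hl0]
  have hly : l ≤ y := by
    have : 1 ≤ δ * Real.log l := by
      rwa [inv_le_iff_one_le_mul₀' hδ0] at hlδ
    nlinarith
  have hyl : y ≤ l ^ 2 := by
    calc y ≤ 1 * l * l := by rw [hydef]; gcongr
      _ = l ^ 2 := by ring
  have hy0 : 0 < y := by linarith
  rw [le_div_iff₀ (by positivity), ← hql] at hexp
  set M := ⌊((q : ℝ) - 1) / y⌋₊ with hM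
  have hMle : (M : ℝ) ≤ (q - 1) / y := Nat.floor_le (div_nonneg (by nlinarith) hy0.le)
  have hMge : (q : ℝ) / (2 * y) ≤ M := by
    have h1 := Nat.lt_floor_add_one (((q : ℝ) - 1) / y)
    refine le_trans ?_ (sub_le_iff_le_add.2 h1.le)
    rw [div_le_iff₀ (by positivity), sub_mul, div_mul_eq_mul_div, le_sub_iff_add_le,
      le_div_iff₀ hy0]
    nlinarith
  have hM1 : 1 ≤ M := by
    have : (1 : ℝ) ≤ M := by
      refine le_trans ?_ hMge
      rw [le_div_iff₀ (by positivity)]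
      nlinarith
    exact_mod_cast this
  have hpM (x : ℝ) (hx : x ≤ y) : x * M < q := by
    calc x * M ≤ y * ((q - 1) / y) := by gcongr
      _ = q - 1 := by field_simp
      _ < q := by linarith
  have hMq : M < q := by
    have := hpM 1 (by linarith)
    rw [one_mul] at this
    exact_mod_cast this
  set S := l ^ (1 - σ) * Real.log l ^ (1 - σ) with hS
  have hpow1 : 1 ≤ l ^ (1 - σ) := Real.one_le_rpow (by linarith) (by linarith [hσ.2])
  have hpow2 : 1 ≤ Real.log l ^ (1 - σ) := Real.one_le_rpow hlogl (by linarith [hσ.2])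
  have hS1 : 1 ≤ S := one_le_mul_of_one_le_of_one_le hpow1 hpow2
  have hSl : S ≤ l ^ 2 := by
    have h1 : l ^ (1 - σ) ≤ l := Real.rpow_le_self_of_one_le (by linarith) (by linarith [hσ'.1])
    have h2 : Real.log l ^ (1 - σ) ≤ Real.log l :=
      Real.rpow_le_self_of_one_le hlogl (by linarith [hσ'.1])
    calc S ≤ l * l := by
          rw [hS]
          gcongr
          exact h2.trans hlogl'
      _ = l ^ 2 := by ring
  have hu : Complex.exp (-(θ : ℂ) * Complex.I) =
      Complex.exp (((-θ : ℝ) : ℂ) * Complex.I) := by push_cast; rfl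
  have hunorm : ‖Complex.exp (-(θ : ℂ) * Complex.I)‖ = 1 := by
    rw [hu, Complex.norm_exp_ofReal_mul_I]
  have hure : (Complex.exp (-(θ : ℂ) * Complex.I)).re = Real.cos θ := by
    rw [hu, Complex.exp_ofReal_mul_I_re, Real.cos_neg]
  have hmain := resonance_inequality (P := Nat.primesLE ⌊y⌋₊) (M := M) (V := c * S)
    (u := Complex.exp (-(θ : ℂ) * Complex.I)) hσ' hq
    (by rw [hql]; exact Real.exp_le_exp.2 hlσ) (fun p hp ↦ (Nat.mem_primesLE.1 hp).2) hM1 hMq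
    (fun p hp ↦ by
      have := hpM p ((Nat.le_floor_iff hy0.le).1 (Nat.mem_primesLE.1 hp).1)
      exact_mod_cast this)
    hunorm.le (by rw [hure]; exact hcos.le) (by positivity)
    (fun χ h1 h0 ↦ by rw [hS, ← mul_assoc]; exact (hcon χ h1 h0).le)
  have herr := resonance_error_le (V := c * S) (C := C) (a := ε / 2) hσ' hql (by linarith)
    (by linarith) hyl hMge (by positivity) (mul_le_mul_of_nonneg_left hSl hc0.le) (by positivity)
    (N := 16 ^ (Nat.primesLE ⌊y⌋₊).card) (by
      rw [show ε / 2 = 6 * δ by rw [hδ]; ring]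
      exact sixteen_pow_primeCounting_le (by linarith) hly hydef hπy)
  rw [show 2 * σ - 1 - ε / 2 = ε / 2 by rw [hε]; ring] at herr
  have hsum : δ ^ (1 - σ) * S / 2 ≤
      ∑ p ∈ Nat.primesLE ⌊y⌋₊, Real.log p * (p : ℝ) ^ (-σ) := by
    refine le_trans ?_ (rpow_neg_mul_theta_le hσ'.1.le hy0.le)
    calc δ ^ (1 - σ) * S / 2 = y ^ (-σ) * (y / 2) := by
          rw [mul_div_assoc', ← Real.rpow_add_one hy0.ne', hydef, neg_add_eq_sub,
            Real.mul_rpow (by positivity) (by positivity), Real.mul_rpow hδ0.le hl0.le, hS]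
          ring
      _ ≤ _ := by gcongr
  rw [hure] at hmain
  have hlower : 4 * (c * S) ≤ Real.cos θ *
      (1 / 2 * ∑ p ∈ Nat.primesLE ⌊y⌋₊, Real.log p * (p : ℝ) ^ (-σ)) := by
    calc 4 * (c * S) = Real.cos θ * (1 / 2 * (δ ^ (1 - σ) * S / 2)) := by
          rw [hc]
          ring
      _ ≤ _ := by gcongr
  have hcS : c ≤ c * S := le_mul_of_one_le_right hc0.le hS1
  have hcS0 : 0 < c * S := by positivity
  linarith
end
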